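/- arXiv:1209.2984 — 16 statements merged into one kernel-verified Lean document; each statement's English description precedes it below -/
import Mathlib

section
/- Let q = p^r be a power of an odd prime p, and let g and l be positive integers such that p does not divide 2g+2, l ≡ -(2g+2) (mod p), and 2g+2 > l(q-1). Then the polynomial f(X) = X^{2g+2} - X^{2g+2-l(q-1)} + 1 in F_q[X] is a monic squarefree polynomial of degree 2g+2 (equivalently, it has no repeated roots in an algebraic closure of F_q), and f(x) = 1 for every x ∈ F_q. -/
open Polynomial

/-- For `q = p^r` a power of an odd prime `p`, positive integers `g, l` with
`p ∤ 2g+2`, `l ≡ -(2g+2) (mod p)` and `2g+2 > l(q-1)`, the polynomial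
`f = X^(2g+2) - X^(2g+2-l(q-1)) + 1 ∈ F_q[X]` is monic, squarefree, of degree `2g+2`,
and `f(x) = 1` for every `x ∈ F_q`. -/
theorem pointless_hyperelliptic_stmt0
    (p r : ℕ) (hp : p.Prime) (hpodd : Odd p) (hr : 0 < r)
    (F : Type*) [Field F] [Fintype F] (hF : Fintype.card F = p ^ r)
    (g l : ℕ) (hg : 0 < g) (hl : 0 < l)
    (hpg : ¬ p ∣ (2 * g + 2))
    (hcong : (l : ZMod p) = -((2 * g + 2 : ℕ) : ZMod p))
    (hlt : l * (p ^ r - 1) < 2 * g + 2) :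
    ((X : F[X]) ^ (2 * g + 2) - X ^ (2 * g + 2 - l * (p ^ r - 1)) + 1).Monic ∧
    Squarefree ((X : F[X]) ^ (2 * g + 2) - X ^ (2 * g + 2 - l * (p ^ r - 1)) + 1) ∧
    ((X : F[X]) ^ (2 * g + 2) - X ^ (2 * g + 2 - l * (p ^ r - 1)) + 1).natDegree
      = 2 * g + 2 ∧
    ∀ x : F,
      ((X : F[X]) ^ (2 * g + 2) - X ^ (2 * g + 2 - l * (p ^ r - 1)) + 1).eval x = 1 := by
  have : Fact p.Prime := ⟨hp⟩
  have hcp : CharP F p := by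
    obtain ⟨c, hc⟩ := CharP.exists F
    have hcprime : c.Prime := CharP.char_is_prime F c
    obtain ⟨k, -, hk⟩ := FiniteField.card F c
    rw [hF] at hk
    have hdvd : c ∣ p ^ r := hk ▸ dvd_pow_self c k.ne_zero
    rwa [(Nat.prime_dvd_prime_iff_eq hcprime hp).mp (hcprime.dvd_of_dvd_pow hdvd)] at hc
  have hq : 1 < p ^ r := Nat.one_lt_pow hr.ne' hp.one_lt
  have hlq : 0 < l * (p ^ r - 1) := Nat.mul_pos hl (by omega)
  set n := 2 * g + 2 with hn
  obtain ⟨m, hm⟩ : ∃ m, n - l * (p ^ r - 1) = m := ⟨_, rfl⟩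
  rw [hm]
  have hnm : n = m + l * (p ^ r - 1) := by omega
  have hm0 : m ≠ 0 := by omega
  have hn0 : n ≠ 0 := by omega
  have hmn : m < n := by omega
  have hnF : (n : F) ≠ 0 := by rwa [Ne, CharP.cast_eq_zero_iff F p]
  have hmF : (m : F) = 0 := by
    have hnl : ((n + l : ℕ) : F) = 0 := by
      rw [CharP.cast_eq_zero_iff F p, ← ZMod.natCast_eq_zero_iff, Nat.cast_add, hcong]
      ring
    have hsum : m + l * p ^ r = n + l := by
      rw [hnm, add_assoc, ← Nat.mul_succ, Nat.succ_eq_add_one, Nat.sub_add_cancel hq.le]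
    rw [← hsum] at hnl
    simpa [hr.ne'] using hnl
  have hrw : (X : F[X]) ^ n - X ^ m + 1 = X ^ n + (1 - X ^ m) := by ring
  have hdeg : (1 - X ^ m : F[X]).degree < n := by
    refine (degree_sub_le _ _).trans_lt (max_lt ?_ ?_)
    · rw [degree_one]
      exact_mod_cast Nat.pos_of_ne_zero hn0
    · rw [degree_X_pow]
      exact_mod_cast hmn
  refine ⟨?_, ?_, ?_, fun x => ?_⟩
  · rw [hrw]
    exact monic_X_pow_add hdeg
  · apply Separable.squarefree
    have hder : derivative ((X : F[X]) ^ n - X ^ m + 1) = C (n : F) * X ^ (n - 1) := by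
      simp [derivative_X_pow, hmF]
    rw [separable_def, hder]
    refine IsCoprime.mul_right ?_ (IsCoprime.pow_right ?_)
    · exact (isCoprime_one_right).of_isCoprime_of_dvd_right (isUnit_C.mpr hnF.isUnit).dvd
    · refine ⟨1, X ^ (m - 1) - X ^ (n - 1), ?_⟩
      rw [sub_mul, pow_sub_one_mul hm0, pow_sub_one_mul hn0]
      ring
  · rw [hrw]
    refine natDegree_eq_of_degree_eq_some ?_
    rw [degree_add_eq_left_of_degree_lt (by rwa [degree_X_pow]), degree_X_pow]
  · simp only [eval_add, eval_sub, eval_pow, eval_X, eval_one]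
    rcases eq_or_ne x 0 with rfl | hx
    · simp [hm0, hn0]
    · have h1 : x ^ (p ^ r - 1) = 1 := hF ▸ FiniteField.pow_card_sub_one_eq_one x hx
      rw [hnm, pow_add, mul_comm l, pow_mul, h1]
      simp
end

section
/- Let q = p^r be a power of an odd prime p, let g be a positive integer, and let a be the least nonnegative residue of g modulo p. Assume a ≤ p-2. If g ≥ (p-a-1)(q-1), then there exists a monic squarefree polynomial f ∈ F_q[X] of degree 2g+2 such that f(x) is a nonzero square in F_q for every x ∈ F_q. -/
open Polynomial

/-- If `k = -1`, `m = 0` and `j ≠ 0` in the field `K`, and the exponent `m` is positive, then the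
polynomial `1 + (X ^ k - 1) ^ j * X ^ m` is separable. -/
theorem separable_one_add_pow_mul_X_pow {K : Type*} [Field K] {k j m : ℕ}
    (hk : (k : K) = -1) (hj : (j : K) ≠ 0) (hm : (m : K) = 0) (hm0 : m ≠ 0) :
    (1 + (X ^ k - 1) ^ j * X ^ m : K[X]).Separable := by
  have hj0 : j ≠ 0 := by rintro rfl; simp at hj
  have hder : derivative (1 + (X ^ k - 1) ^ j * X ^ m : K[X]) =
      C (-(j : K)) * ((X ^ k - 1) ^ (j - 1) * (X ^ (k - 1) * X ^ m)) := by
    have hk' : (k : K[X]) = -1 := by simpa using congrArg (C : K → K[X]) hk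
    have hm' : (m : K[X]) = 0 := by simpa using congrArg (C : K → K[X]) hm
    simp [derivative_pow, derivative_mul, hk', hm']
    ring
  have hw : IsCoprime (1 + (X ^ k - 1) ^ j * X ^ m : K[X]) (X ^ k - 1) := by
    obtain ⟨i, rfl⟩ := Nat.exists_eq_succ_of_ne_zero hj0
    exact ⟨1, -((X ^ k - 1) ^ i * X ^ m), by rw [pow_succ]; ring⟩
  have hX : IsCoprime (1 + (X ^ k - 1) ^ j * X ^ m : K[X]) X := by
    obtain ⟨i, rfl⟩ := Nat.exists_eq_succ_of_ne_zero hm0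
    exact ⟨1, -((X ^ k - 1) ^ j * X ^ i), by rw [pow_succ]; ring⟩
  rw [separable_def, hder]
  refine IsCoprime.mul_right ?_ (hw.pow_right.mul_right (hX.pow_right.mul_right hX.pow_right))
  exact (isCoprime_one_right.of_isCoprime_of_dvd_right
    (isUnit_C.2 (neg_ne_zero.2 hj).isUnit).dvd)

/-- For `q = p^r` a power of an odd prime `p`, `g` a positive integer with
least nonnegative residue `a` mod `p` satisfying `a ≤ p-2`, if `g ≥ (p-a-1)(q-1)` then
there is a monic squarefree polynomial `f ∈ F_q[X]` of degree `2g+2` such that `f(x)`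
is a nonzero square in `F_q` for every `x ∈ F_q`. -/
theorem pointless_hyperelliptic_stmt1
    (p r : ℕ) (hp : p.Prime) (hpodd : Odd p) (hr : 0 < r)
    (F : Type*) [Field F] [Fintype F] (hF : Fintype.card F = p ^ r)
    (g : ℕ) (hg : 0 < g) (a : ℕ) (ha : a = g % p) (hale : a ≤ p - 2)
    (hge : (p - a - 1) * (p ^ r - 1) ≤ g) :
    ∃ f : F[X], f.Monic ∧ Squarefree f ∧ f.natDegree = 2 * g + 2 ∧
      ∀ x : F, f.eval x ≠ 0 ∧ IsSquare (f.eval x) := by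
  have := Fact.mk hp
  have hchar : CharP F p := charP_of_card_eq_prime_pow hF
  have hp2 := hp.two_le
  obtain ⟨k, hk⟩ : ∃ k, p ^ r = k + 1 := Nat.exists_eq_succ_of_ne_zero (by positivity)
  have hk0 : k ≠ 0 := by
    rintro rfl
    exact absurd hk (Nat.one_lt_pow hr.ne' hp.one_lt).ne'
  obtain ⟨b, hb⟩ : ∃ b, b = p - a - 1 := ⟨_, rfl⟩
  rw [← hb, hk, Nat.add_sub_cancel] at hge
  obtain ⟨t, ht⟩ : ∃ t, g = b * k + t := Nat.exists_eq_add_of_le hge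
  have hpF : (p : F) = 0 := CharP.cast_eq_zero F p
  have hkF : (k : F) = -1 := by
    have h := congrArg (Nat.cast : ℕ → F) hk
    rw [Nat.cast_pow, hpF, zero_pow hr.ne'] at h
    push_cast at h
    linear_combination -h
  have hbF : ((2 * b : ℕ) : F) ≠ 0 := by
    rw [Ne, CharP.cast_eq_zero_iff F p, hp.dvd_mul, not_or]
    refine ⟨fun h => ?_, Nat.not_dvd_of_pos_of_lt (by omega) (by omega)⟩
    have h2 := Nat.le_of_dvd two_pos h
    obtain ⟨c, hc⟩ := hpodd
    omega
  have hmF : ((2 * (t + 1) : ℕ) : F) = 0 := by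
    have hgF := congrArg (Nat.cast : ℕ → F) (Nat.div_add_mod g p)
    have hbaF := congrArg (Nat.cast : ℕ → F) (show b + a + 1 = p by omega)
    have htF := congrArg (Nat.cast : ℕ → F) ht
    rw [← ha] at hgF
    push_cast [hpF, hkF] at hgF hbaF htF ⊢
    linear_combination 2 * (hbaF - hgF - htF)
  have hlead : ((X ^ k - 1) ^ (2 * b) * X ^ (2 * (t + 1)) : F[X]).Monic :=
    ((monic_X_pow_sub_C 1 hk0).pow _).mul (monic_X_pow _)
  have hleaddeg : ((X ^ k - 1) ^ (2 * b) * X ^ (2 * (t + 1)) : F[X]).natDegree = 2 * g + 2 := by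
    have hw : (X ^ k - 1 : F[X]).Monic := monic_X_pow_sub_C 1 hk0
    have hwd : (X ^ k - 1 : F[X]).natDegree = k := natDegree_X_pow_sub_C (r := (1 : F))
    rw [(hw.pow _).natDegree_mul (monic_X_pow _), hw.natDegree_pow, natDegree_X_pow, hwd, ht]
    ring
  have hlt : (1 : F[X]).natDegree <
      ((X ^ k - 1) ^ (2 * b) * X ^ (2 * (t + 1)) : F[X]).natDegree := by
    rw [hleaddeg, natDegree_one]
    omega
  refine ⟨1 + (X ^ k - 1) ^ (2 * b) * X ^ (2 * (t + 1)),
    hlead.add_of_right (degree_lt_degree hlt),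
    (separable_one_add_pow_mul_X_pow hkF hbF hmF (by omega)).squarefree,
    (natDegree_add_eq_right_of_natDegree_lt hlt).trans hleaddeg, fun x => ?_⟩
  have hx : eval x (1 + (X ^ k - 1) ^ (2 * b) * X ^ (2 * (t + 1)) : F[X]) = 1 := by
    rcases eq_or_ne x 0 with rfl | hx0
    · simp
    · have hxk : x ^ k = 1 := by
        have h := FiniteField.pow_card_sub_one_eq_one x hx0
        rwa [hF, hk, Nat.add_sub_cancel] at h
      have hb0 : b ≠ 0 := by omega
      simp [hxk, hb0]
  rw [hx]
  exact ⟨one_ne_zero, IsSquare.one⟩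
end

section
/- Let q = p^r be a power of an odd prime p, let g be a positive integer, and let a be the least nonnegative residue of g modulo p. Assume 0 ≤ a ≤ (p-3)/2. If g ≥ (q-1)(p-2a-2)/2, then there exists a monic squarefree polynomial f ∈ F_q[X] of degree 2g+2 such that f(x) is a nonzero square in F_q for every x ∈ F_q. -/
open Polynomial

/-- The trinomial `X ^ n - X ^ m + 1` is separable when `m` vanishes in the field and `n` does not:
its derivative is a nonzero multiple of `X ^ (n - 1)`. -/
theorem separable_X_pow_sub_X_pow_add_one {F : Type*} [Field F] {n m : ℕ} (hm : (m : F) = 0)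
    (hn : (n : F) ≠ 0) (hm0 : m ≠ 0) : (X ^ n - X ^ m + 1 : F[X]).Separable := by
  have hn0 : n ≠ 0 := by
    rintro rfl
    simp at hn
  have hder : derivative (X ^ n - X ^ m + 1 : F[X]) = C (n : F) * X ^ (n - 1) := by
    rw [derivative_add, derivative_sub, derivative_X_pow, derivative_X_pow, derivative_one, hm]
    simp
  have hX : IsCoprime (X ^ n - X ^ m + 1 : F[X]) X := by
    obtain ⟨i, rfl⟩ := Nat.exists_eq_succ_of_ne_zero hn0
    obtain ⟨j, rfl⟩ := Nat.exists_eq_succ_of_ne_zero hm0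
    exact ⟨1, X ^ j - X ^ i, by rw [pow_succ, pow_succ]; ring⟩
  rw [Separable, hder]
  exact (isCoprime_mul_unit_left_right (isUnit_C.2 hn.isUnit) _ _).2 hX.pow_right

/-- For `q = p^r` a power of an odd prime `p`, `g` a positive integer with
least nonnegative residue `a` mod `p` satisfying `0 ≤ a ≤ (p-3)/2`, if
`g ≥ (q-1)(p-2a-2)/2` then there is a monic squarefree polynomial `f ∈ F_q[X]` of degree
`2g+2` such that `f(x)` is a nonzero square in `F_q` for every `x ∈ F_q`. -/
theorem pointless_hyperelliptic_stmt2
    (p r : ℕ) (hp : p.Prime) (hpodd : Odd p) (hr : 0 < r)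
    (F : Type*) [Field F] [Fintype F] (hF : Fintype.card F = p ^ r)
    (g : ℕ) (hg : 0 < g) (a : ℕ) (ha : a = g % p) (hale : a ≤ (p - 3) / 2)
    (hge : (p ^ r - 1) * (p - 2 * a - 2) / 2 ≤ g) :
    ∃ f : F[X], f.Monic ∧ Squarefree f ∧ f.natDegree = 2 * g + 2 ∧
      ∀ x : F, f.eval x ≠ 0 ∧ IsSquare (f.eval x) := by
  have : Fact p.Prime := ⟨hp⟩
  have : CharP F p := charP_of_card_eq_prime_pow hF
  have hp3 : 3 ≤ p := by
    obtain ⟨c, hc⟩ := hpodd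
    have := hp.two_le
    omega
  obtain ⟨k, hk⟩ : ∃ k, p = 2 * a + 2 + k := ⟨p - 2 * a - 2, by omega⟩
  have hk0 : k ≠ 0 := by omega
  have hq : 1 < p ^ r := Nat.one_lt_pow hr.ne' hp.one_lt
  obtain ⟨c, hc⟩ : Odd (p ^ r) := hpodd.pow
  have hle : (p ^ r - 1) * k ≤ 2 * g := by
    have h1 : p - 2 * a - 2 = k := by omega
    have h2 : (p ^ r - 1) * k = 2 * (c * k) := by rw [hc, Nat.add_sub_cancel]; ring
    rw [h1] at hge
    omega
  obtain ⟨m, hm⟩ : ∃ m, 2 * g + 2 = m + (p ^ r - 1) * k :=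
    ⟨2 * g + 2 - (p ^ r - 1) * k, by omega⟩
  have hm0 : m ≠ 0 := by omega
  have hlt : m < 2 * g + 2 := by
    have : 0 < (p ^ r - 1) * k := Nat.mul_pos (by omega) (by omega)
    omega
  have hp0 : (p : F) = 0 := CharP.cast_eq_zero F p
  have hga : (g : F) = a := by
    conv_lhs => rw [← Nat.mod_add_div g p, ← ha]
    simp
  have hn : ((2 * g + 2 : ℕ) : F) ≠ 0 := by
    have h : ((2 * g + 2 : ℕ) : F) = ((2 * a + 2 : ℕ) : F) := by
      push_cast
      rw [hga]
    rw [h, Ne, CharP.cast_eq_zero_iff F p]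
    exact Nat.not_dvd_of_pos_of_lt (by omega) (by omega)
  have hmF : (m : F) = 0 := by
    have h1 : ((2 * g + 2 : ℕ) : F) = ((m + (p ^ r - 1) * k : ℕ) : F) := by rw [hm]
    have h2 : ((2 * a + 2 + k : ℕ) : F) = 0 := by rw [← hk, hp0]
    push_cast [Nat.cast_sub hq.le] at h1 h2
    rw [hga, hp0, zero_pow hr.ne'] at h1
    linear_combination h2 - h1
  have hdeg : (X ^ (2 * g + 2) - X ^ m + 1 : F[X]) = X ^ (2 * g + 2) + (1 - X ^ m) := by ring
  have hlow : (1 - X ^ m : F[X]).degree < (2 * g + 2 : ℕ) := by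
    refine (degree_sub_le _ _).trans_lt (max_lt ?_ ?_)
    · rw [degree_one]
      exact_mod_cast Nat.succ_pos _
    · rw [degree_X_pow]
      exact_mod_cast hlt
  refine ⟨X ^ (2 * g + 2) - X ^ m + 1, ?_,
    (separable_X_pow_sub_X_pow_add_one hmF hn hm0).squarefree, ?_, fun x ↦ ?_⟩
  · rw [hdeg]
    exact monic_X_pow_add hlow
  · rw [hdeg, natDegree_eq_of_degree_eq_some]
    rw [degree_add_eq_left_of_degree_lt (by rwa [degree_X_pow]), degree_X_pow]
  · have h : (X ^ (2 * g + 2) - X ^ m + 1 : F[X]).eval x = 1 := by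
      rcases eq_or_ne x 0 with rfl | hx
      · simp [hm0]
      · have hx1 : x ^ (p ^ r - 1) = 1 := hF ▸ FiniteField.pow_card_sub_one_eq_one x hx
        simp [hm, pow_add, pow_mul, hx1]
    rw [h]
    exact ⟨one_ne_zero, IsSquare.one⟩
end

section
/- Let p be an odd prime, let g be a positive integer, and let a be the least nonnegative residue of g modulo p. If g ≥ (p-a)(p-2), then there exists a pointless hyperelliptic curve of genus g over F_p. -/
open Polynomial

/-- The polynomial `X ^ D - (X ^ (p - 1) - 1) * W ^ p`, where `W = C b * X ^ j + C s`. It takes the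
value `x ^ D` at every nonzero `x : ZMod p`, and the value `W(0)` at `0`. -/
noncomputable def twistedTrinomial (p D j : ℕ) (b s : ZMod p) : (ZMod p)[X] :=
  X ^ D + -((X ^ (p - 1) - 1) * (C b * X ^ j + C s) ^ p)

lemma twistedTrinomial_degree_tail_lt {p D j : ℕ} [Fact p.Prime] {b : ZMod p} (s : ZMod p)
    (hD : p - 1 < D) (hj : b = 0 ∨ p - 1 + p * j < D) :
    (-((X ^ (p - 1) - 1) * (C b * X ^ j + C s) ^ p) : (ZMod p)[X]).degree < D := by
  have hX : (X ^ (p - 1) - 1 : (ZMod p)[X]).natDegree ≤ p - 1 := by compute_degree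
  rw [degree_neg]
  refine lt_of_le_of_lt degree_le_natDegree (Nat.cast_lt.mpr ?_)
  refine lt_of_le_of_lt (natDegree_mul_le.trans (add_le_add hX natDegree_pow_le)) ?_
  rcases hj with rfl | hj
  · simpa using hD
  · have hW : (C b * X ^ j + C s : (ZMod p)[X]).natDegree ≤ j := by compute_degree
    exact lt_of_le_of_lt (by gcongr) hj

lemma isSquare_eval_twistedTrinomial {p D j : ℕ} [Fact p.Prime] {b s : ZMod p}
    (hD : Even D) (hD0 : D ≠ 0) (hp1 : p - 1 ≠ 0) (h0 : IsSquare (b * 0 ^ j + s))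
    (h0' : b * 0 ^ j + s ≠ 0) (x : ZMod p) :
    IsSquare ((twistedTrinomial p D j b s).eval x) ∧
      (twistedTrinomial p D j b s).eval x ≠ 0 := by
  rcases eq_or_ne x 0 with rfl | hx
  · have : (twistedTrinomial p D j b s).eval 0 = b * 0 ^ j + s := by
      simp [twistedTrinomial, zero_pow hD0, zero_pow hp1, ZMod.pow_card]
    rw [this]
    exact ⟨h0, h0'⟩
  · have : (twistedTrinomial p D j b s).eval x = x ^ D := by
      simp [twistedTrinomial, ZMod.pow_card_sub_one_eq_one hx]
    rw [this]
    exact ⟨hD.isSquare_pow x, pow_ne_zero _ hx⟩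

lemma separable_twistedTrinomial {p i c : ℕ} [Fact p.Prime] (hp2 : 2 < p)
    (hic : i ≠ 0 ∨ c ≠ 0) {s : ZMod p} (hs : s ≠ 0)
    (h0 : (2 * c : ZMod p) * ((2 * c : ZMod p) / (2 * c - 1)) ^ (2 * c - 1) * 0 ^ (2 * i) + s ≠ 0) :
    (twistedTrinomial p (2 * (i * p + c * (p - 1))) (2 * i)
      ((2 * c : ZMod p) * ((2 * c : ZMod p) / (2 * c - 1)) ^ (2 * c - 1)) s).Separable := by
  set d : ZMod p := 2 * c with hd
  set b : ZMod p := d * (d / (d - 1)) ^ (2 * c - 1) with hb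
  clear_value b d
  obtain ⟨q, rfl⟩ : ∃ q, p = q + 2 := ⟨p - 2, by omega⟩
  obtain ⟨e, he⟩ : ∃ e, 2 * (i * (q + 2) + c * (q + 1)) = q + 1 + e := by
    refine ⟨2 * (i * (q + 2) + c * (q + 1)) - (q + 1), ?_⟩
    rcases hic with h | h
    · have := Nat.mul_le_mul_right (q + 2) (Nat.one_le_iff_ne_zero.mpr h)
      omega
    · have := Nat.mul_le_mul_right (q + 1) (Nat.one_le_iff_ne_zero.mpr h)
      omega
  have hpc : ((q : ZMod (q + 2)) + 2) = 0 := by exact_mod_cast ZMod.natCast_self (q + 2)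
  have hDc : ((q + 1 + e : ℕ) : ZMod (q + 2)) = -d := by
    rw [← he, hd]
    push_cast
    linear_combination (2 * i + 2 * c : ZMod (q + 2)) * hpc
  have hq1 : ((q + 1 : ℕ) : ZMod (q + 2)) = -1 := by
    push_cast
    linear_combination hpc
  let K := AlgebraicClosure (ZMod (q + 2))
  have : CharP K (q + 2) := charP_of_injective_algebraMap (algebraMap (ZMod (q + 2)) K).injective _
  rw [Polynomial.Separable, isCoprime_iff_aeval_ne_zero_of_isAlgClosed (ZMod (q + 2)) K]
  by_contra! hcon
  obtain ⟨x, hf, hf'⟩ := hcon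
  have hder : derivative (twistedTrinomial (q + 2) (q + 1 + e) (2 * i) b s) =
      X ^ q * ((C b * X ^ (2 * i) + C s) ^ (q + 2) - C d * X ^ e) := by
    have hW : derivative ((C b * X ^ (2 * i) + C s : (ZMod (q + 2))[X]) ^ (q + 2)) = 0 := by
      rw [derivative_pow, CharP.cast_eq_zero]
      simp
    rw [twistedTrinomial, derivative_add, derivative_neg, derivative_mul, hW, derivative_sub,
      derivative_X_pow, show q + 2 - 1 = q + 1 by omega, derivative_X_pow, hDc, hq1,
      show q + 1 + e - 1 = q + e by omega, Nat.add_sub_cancel, derivative_one]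
    simp only [map_neg, map_one]
    ring
  rw [show q + 2 - 1 = q + 1 by omega, he] at hf hf'
  rw [hder] at hf'
  have hWx : (aeval x (C b * X ^ (2 * i) + C s)) ^ (q + 2) =
      algebraMap _ K b * (x ^ (q + 2)) ^ (2 * i) + algebraMap _ K s := by
    simp only [map_add, map_mul, map_pow, aeval_C, aeval_X]
    rw [add_pow_char, mul_pow, ← map_pow, ← map_pow, ZMod.pow_card, ZMod.pow_card, pow_right_comm]
  rw [map_mul, map_pow, aeval_X, map_sub, map_pow, hWx, map_mul, aeval_C, map_pow, aeval_X] at hf'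
  rw [twistedTrinomial, show q + 2 - 1 = q + 1 by omega, map_add, map_neg, map_mul,
    map_pow _ _ (q + 2), hWx, map_sub, map_pow, map_pow, aeval_X, map_one] at hf
  have hx : x ≠ 0 := by
    rintro rfl
    apply h0
    apply (algebraMap (ZMod (q + 2)) K).injective
    have h1 : (-1 : K) ≠ 0 := neg_ne_zero.mpr one_ne_zero
    simpa [h1] using hf
  have hWe := sub_eq_zero.mp ((mul_eq_zero.mp hf').resolve_left (pow_ne_zero _ hx))
  rw [hWe] at hf
  have hy : (algebraMap _ K (d - 1)) * x ^ (q + 1) = algebraMap _ K d := by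
    rw [map_sub, map_one]
    refine mul_left_cancel₀ (pow_ne_zero e hx) ?_
    rw [pow_add] at hf
    linear_combination -hf
  have hd1 : d - 1 ≠ 0 := by
    intro h
    rw [h, map_zero, zero_mul, sub_eq_zero.mp h, map_one] at hy
    exact zero_ne_one hy
  have hd1' : algebraMap _ K (d - 1) ≠ 0 := (_root_.map_ne_zero _).mpr hd1
  have hy' : algebraMap _ K (d / (d - 1)) = x ^ (q + 1) := by
    rw [map_div₀, div_eq_iff hd1', ← hy, mul_comm]
  have hbe : algebraMap _ K b * (x ^ (q + 2)) ^ (2 * i) = algebraMap _ K d * x ^ e := by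
    rcases Nat.eq_zero_or_pos c with hc | hc
    · simp [hb, hd, hc]
    · obtain ⟨r, rfl⟩ : ∃ r, c = r + 1 := ⟨c - 1, by omega⟩
      rw [hb, map_mul, map_pow, hy', ← pow_mul, ← pow_mul, mul_assoc, ← pow_add]
      congr 2
      rw [show 2 * (r + 1) - 1 = 2 * r + 1 by omega]
      nlinarith
  rw [hbe] at hWe
  exact hs (by simpa using hWe)

theorem pointless_hyperelliptic_stmt3
    (p : ℕ) (hp : p.Prime) (hpodd : Odd p)
    (g : ℕ) (hg : 0 < g) (a : ℕ) (ha : a = g % p)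
    (hge : (p - a) * (p - 2) ≤ g) :
    ∃ f : Polynomial (ZMod p), Squarefree f ∧ f.natDegree = 2 * g + 2 ∧
      ¬ IsSquare f.leadingCoeff ∧ ∀ x : ZMod p, ¬ IsSquare (f.eval x) := by
  have : Fact p.Prime := ⟨hp⟩
  have hp2 : 2 < p := by
    have := hp.two_le
    rcases hpodd with ⟨m, rfl⟩
    omega
  obtain ⟨i, c, hgic, hi0⟩ : ∃ i c, g + 1 = i * p + c * (p - 1) ∧ (i = 0 → c = p - 1) := by
    obtain ⟨c, hc⟩ : ∃ c, p = a + c + 1 := by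
      have := Nat.mod_lt g hp.pos
      exact ⟨p - a - 1, by omega⟩
    have hk := Nat.div_add_mod g p
    rw [← ha] at hk
    have hck : c ≤ g / p + 1 := by
      by_contra! hlt
      obtain ⟨r, hr⟩ : ∃ r, c = g / p + 2 + r := ⟨c - (g / p + 2), by omega⟩
      obtain ⟨q, rfl⟩ : ∃ q, p = q + 2 := ⟨p - 2, by omega⟩
      rw [show q + 2 - a = c + 1 by omega, show q + 2 - 2 = q by omega] at hge
      generalize g / (q + 2) = t at *
      subst hr
      nlinarith
    obtain ⟨i, hi⟩ := Nat.exists_eq_add_of_le hck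
    obtain ⟨q, rfl⟩ : ∃ q, p = q + 2 := ⟨p - 2, by omega⟩
    rw [show q + 2 - a = c + 1 by omega, show q + 2 - 2 = q by omega] at hge
    rw [show q + 2 - 1 = q + 1 by omega]
    generalize g / (q + 2) = t at *
    have : (q + 2) * (t + 1) = (q + 2) * (c + i) := by rw [hi]
    refine ⟨i, c, by nlinarith, ?_⟩
    rintro rfl
    have : q + 1 ≤ c := by nlinarith
    omega
  have hic : i ≠ 0 ∨ c ≠ 0 := by
    by_contra! h
    simp [h.1, h.2] at hgic
  obtain ⟨n, hn⟩ : ∃ n : ZMod p, ¬ IsSquare n :=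
    FiniteField.exists_nonsquare (by rw [ZMod.ringChar_zmod_n]; omega)
  set b : ZMod p := (2 * c : ZMod p) * ((2 * c : ZMod p) / (2 * c - 1)) ^ (2 * c - 1) with hb
  obtain ⟨s, hs, h0, h0'⟩ : ∃ s : ZMod p, s ≠ 0 ∧ IsSquare (b * 0 ^ (2 * i) + s) ∧
      b * 0 ^ (2 * i) + s ≠ 0 := by
    suffices h : ∃ t : ZMod p, IsSquare t ∧ t ≠ 0 ∧ t ≠ b * 0 ^ (2 * i) by
      obtain ⟨t, htsq, ht, htb⟩ := h
      exact ⟨t - b * 0 ^ (2 * i), sub_ne_zero.mpr htb, by simpa using htsq, by simpa using ht⟩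
    by_cases hb1 : b * 0 ^ (2 * i) = 1
    · have hp3 : p ≠ 3 := by
        rintro rfl
        rcases eq_or_ne i 0 with rfl | hi
        · rw [hb, hi0 rfl] at hb1
          have hd : (2 * 2 : ZMod 3) = 1 := by rfl
          simp [hd] at hb1
        · simp [hi] at hb1
      have h2 : (2 : ZMod p) ≠ 0 := by
        rw [← Nat.cast_ofNat, Ne, ZMod.natCast_eq_zero_iff]
        exact fun h => absurd (Nat.le_of_dvd two_pos h) (by omega)
      have h3 : (3 : ZMod p) ≠ 0 := by
        rw [← Nat.cast_ofNat, Ne, ZMod.natCast_eq_zero_iff]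
        exact fun h => hp3 ((Nat.prime_dvd_prime_iff_eq hp Nat.prime_three).mp h)
      refine ⟨2 * 2, ⟨2, rfl⟩, mul_ne_zero h2 h2, fun h => h3 ?_⟩
      linear_combination h + hb1
    · exact ⟨1, IsSquare.one, one_ne_zero, fun h => hb1 h.symm⟩
  have hD : p - 1 < 2 * (i * p + c * (p - 1)) := by
    rcases hic with h | h
    · have := Nat.mul_le_mul_right p (Nat.one_le_iff_ne_zero.mpr h)
      omega
    · have := Nat.mul_le_mul_right (p - 1) (Nat.one_le_iff_ne_zero.mpr h)
      omega
  have hdeg := twistedTrinomial_degree_tail_lt (b := b) (j := 2 * i) s hD (by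
    rcases eq_or_ne c 0 with rfl | h
    · left
      simp [hb]
    · right
      have := Nat.mul_le_mul_right (p - 1) (Nat.one_le_iff_ne_zero.mpr h)
      have : p * (2 * i) = 2 * (i * p) := by ring
      omega)
  have hmonic : (twistedTrinomial p (2 * (i * p + c * (p - 1))) (2 * i) b s).Monic :=
    monic_X_pow_add hdeg
  have hndeg : (twistedTrinomial p (2 * (i * p + c * (p - 1))) (2 * i) b s).natDegree =
      2 * (i * p + c * (p - 1)) := by
    refine natDegree_eq_of_degree_eq_some ?_
    rw [twistedTrinomial, degree_add_eq_left_of_degree_lt, degree_X_pow]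
    rwa [degree_X_pow]
  have hn0 : n ≠ 0 := by
    rintro rfl
    exact hn (IsSquare.zero)
  have hsep := separable_twistedTrinomial hp2 hic hs h0'
  rw [← hb] at hsep
  refine ⟨C n * twistedTrinomial p (2 * (i * p + c * (p - 1))) (2 * i) b s, ?_, ?_, ?_, ?_⟩
  · exact (hsep.unit_mul (isUnit_C.mpr hn0.isUnit)).squarefree
  · rw [natDegree_C_mul hn0, hndeg, ← hgic]
    ring
  · rwa [leadingCoeff_C_mul_of_isUnit hn0.isUnit, hmonic.leadingCoeff, mul_one]
  · intro x hx
    obtain ⟨hsq, hne⟩ := isSquare_eval_twistedTrinomial (D := 2 * (i * p + c * (p - 1)))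
      (even_two_mul _) (by omega) (by omega) h0 h0' x
    rw [eval_C_mul] at hx
    apply hn
    simpa [hne] using hx.div hsq
end

section
/- Let p be an odd prime. For every integer g with g ≥ (p+1)(p-2)/2, there exists a pointless hyperelliptic curve of genus g over F_p. -/
open Polynomial

/-- If `d ≥ p(p-1)`, there is a smaller positive exponent `e`, congruent to `d` modulo `p - 1`,
such that exactly one of `d` and `e` is divisible by `p`. -/
lemma exists_exponent_congr_pred {p d : ℕ} (hp : 3 ≤ p) (hd : p * (p - 1) ≤ d) :
    ∃ e j : ℕ, 0 < e ∧ e < d ∧ d = e + (p - 1) * j ∧ (p ∣ d ↔ ¬ p ∣ e) := by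
  obtain ⟨q, rfl⟩ : ∃ q, p = q + 1 := ⟨p - 1, by omega⟩
  simp only [Nat.add_sub_cancel] at hd ⊢
  by_cases h : q + 1 ∣ d
  · have hqd : q < d := by nlinarith
    refine ⟨d - q, 1, by omega, by omega, by omega, iff_of_true h fun he => ?_⟩
    have hq := (Nat.dvd_sub_iff_right hqd.le h).1 he
    exact absurd (Nat.le_of_dvd (by omega) hq) (by omega)
  · have hd0 : 0 < d := Nat.pos_of_ne_zero fun h0 => h (h0 ▸ dvd_zero _)
    set t := (d - 1) % q + 1 with ht
    have htq : t ≤ q := Nat.mod_lt _ (by omega)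
    have hdt : d = t + q * ((d - 1) / q) := by
      have := Nat.mod_add_div (d - 1) q
      omega
    have hle : (q + 1) * t ≤ d := (Nat.mul_le_mul_left _ htq).trans hd
    have hlt : (q + 1) * t < d := hle.lt_of_ne fun he => h ⟨t, he.symm⟩
    have hj : t ≤ (d - 1) / q := by
      have : q * t ≤ q * ((d - 1) / q) := by linarith
      exact Nat.le_of_mul_le_mul_left this (by omega)
    obtain ⟨j, hj⟩ := Nat.exists_eq_add_of_le hj
    refine ⟨(q + 1) * t, j, by positivity, hlt, ?_, iff_of_false h (by simp)⟩
    rw [hj] at hdt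
    linarith

/-- A trinomial `a (1 + X ^ d - X ^ e)` over a field of characteristic `p` is separable when
exactly one of its positive exponents is divisible by `p`. -/
lemma separable_C_mul_one_add_X_pow_sub_X_pow {F : Type*} [Field F] (p : ℕ) [CharP F p]
    {a : F} (ha : a ≠ 0) {d e : ℕ} (hd : 0 < d) (he : 0 < e) (h : p ∣ d ↔ ¬ p ∣ e) :
    (C a * (1 + X ^ d - X ^ e) : F[X]).Separable := by
  have hX : IsCoprime (1 + X ^ d - X ^ e : F[X]) X := by
    obtain ⟨d, rfl⟩ := Nat.exists_eq_add_one.2 hd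
    obtain ⟨e, rfl⟩ := Nat.exists_eq_add_one.2 he
    exact ⟨1, X ^ e - X ^ d, by ring⟩
  have key : ∀ (c : F) (k : ℕ), c ≠ 0 → IsCoprime (1 + X ^ d - X ^ e : F[X]) (C c * X ^ k) :=
    fun c k hc => (isCoprime_mul_unit_left_right (isUnit_C.2 hc.isUnit) _ _).2 hX.pow_right
  refine Separable.unit_mul (isUnit_C.2 ha.isUnit) ?_
  rw [Separable]
  by_cases hpd : p ∣ d
  · have hd0 : (d : F) = 0 := (CharP.cast_eq_zero_iff F p d).2 hpd
    have he0 : (e : F) ≠ 0 := fun h0 => h.1 hpd ((CharP.cast_eq_zero_iff F p e).1 h0)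
    convert key (-e) (e - 1) (neg_ne_zero.2 he0) using 1
    simp [derivative_X_pow, hd0]
  · have hd0 : (d : F) ≠ 0 := fun h0 => hpd ((CharP.cast_eq_zero_iff F p d).1 h0)
    have he0 : (e : F) = 0 := (CharP.cast_eq_zero_iff F p e).2 (not_not.1 (mt h.2 hpd))
    convert key d (d - 1) hd0 using 1
    simp [derivative_X_pow, he0]

/-- For an odd prime `p` and every integer `g ≥ (p+1)(p-2)/2`, there exists
a pointless hyperelliptic curve of genus `g` over `F_p`, i.e. a squarefree polynomial
`f ∈ F_p[X]` of degree `2g+2` whose leading coefficient is not a square and with `f(x)`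
not a square for every `x ∈ F_p`. -/
theorem pointless_hyperelliptic_stmt4
    (p : ℕ) (hp : p.Prime) (hpodd : Odd p)
    (g : ℕ) (hge : (p + 1) * (p - 2) / 2 ≤ g) :
    ∃ f : Polynomial (ZMod p), Squarefree f ∧ f.natDegree = 2 * g + 2 ∧
      ¬ IsSquare f.leadingCoeff ∧ ∀ x : ZMod p, ¬ IsSquare (f.eval x) := by
  have : Fact p.Prime := ⟨hp⟩
  have hp2 : p ≠ 2 := by rintro rfl; exact absurd hpodd (by decide)
  have hp3 : 3 ≤ p := hp.two_le.lt_of_ne' hp2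
  obtain ⟨a, ha⟩ := FiniteField.exists_nonsquare (F := ZMod p) (by rwa [ZMod.ringChar_zmod_n])
  have ha0 : a ≠ 0 := by rintro rfl; exact ha IsSquare.zero
  have hdeg : p * (p - 1) ≤ 2 * g + 2 := by
    obtain ⟨k, rfl⟩ := hpodd
    obtain ⟨m, rfl⟩ := Nat.exists_eq_add_of_le' (show 1 ≤ k by omega)
    have h : (2 * (m + 1) + 1 + 1) * (2 * (m + 1) + 1 - 2) = 2 * ((m + 2) * (2 * m + 1)) := by
      rw [show 2 * (m + 1) + 1 - 2 = 2 * m + 1 by omega]; ring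
    rw [h, Nat.mul_div_cancel_left _ two_pos] at hge
    rw [Nat.add_sub_cancel]
    nlinarith
  obtain ⟨e, j, he, hed, hj, hdvd⟩ := exists_exponent_congr_pred hp3 hdeg
  have hlt : (1 - X ^ e : (ZMod p)[X]).degree < ((2 * g + 2 : ℕ) : WithBot ℕ) := by
    refine (degree_sub_le _ _).trans_lt (max_lt ?_ ?_)
    · rw [degree_one]; exact_mod_cast Nat.succ_pos _
    · rw [degree_X_pow]; exact_mod_cast hed
  have hrw : (1 + X ^ (2 * g + 2) - X ^ e : (ZMod p)[X]) = X ^ (2 * g + 2) + (1 - X ^ e) := by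
    ring
  refine ⟨C a * (1 + X ^ (2 * g + 2) - X ^ e),
    (separable_C_mul_one_add_X_pow_sub_X_pow p ha0 (Nat.succ_pos _) he hdvd).squarefree,
    ?_, ?_, fun x => ?_⟩
  · rw [natDegree_C_mul ha0, hrw]
    rw [natDegree_add_eq_left_of_degree_lt (by rwa [degree_X_pow]), natDegree_X_pow]
  · rwa [leadingCoeff_mul, leadingCoeff_C, hrw, (monic_X_pow_add hlt).leadingCoeff, mul_one]
  · have hx : x ^ (2 * g + 2) = x ^ e := by
      rcases eq_or_ne x 0 with rfl | hx0
      · rw [zero_pow (by omega), zero_pow he.ne']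
      · rw [hj, pow_add, pow_mul, ZMod.pow_card_sub_one_eq_one hx0, one_pow, mul_one]
    simpa [hx] using ha
end

section
/- Let p ≥ 5 be a prime and let g be a positive integer such that gcd(g+1, (p-1)/2) = 1 and g ≥ (p-1)/2. Then there exists a pointless hyperelliptic curve of genus g over F_p. -/
open Polynomial

/-- If `n` is a nonsquare and `h` is monic, then `n * (1 + (X ^ p - X) * h)` takes only nonsquare
values on `ZMod p`; it is squarefree as soon as `1 + (X ^ p - X) * h` and its derivative have no
common root. -/
lemma exists_squarefree_nonsquare_of_monic {p : ℕ} [Fact p.Prime] (hp2 : p ≠ 2)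
    {d : ℕ} {h : (ZMod p)[X]} (hm : h.Monic) (hd : p + h.natDegree = d)
    (hroot : ∀ x : AlgebraicClosure (ZMod p), (x ^ p - x) * aeval x h = -1 →
      (x ^ p - x) * aeval x (derivative h) ≠ aeval x h) :
    ∃ f : (ZMod p)[X], Squarefree f ∧ f.natDegree = d ∧
      ¬ IsSquare f.leadingCoeff ∧ ∀ x : ZMod p, ¬ IsSquare (f.eval x) := by
  have hp := Fact.out (p := p.Prime)
  obtain ⟨n, hn⟩ := FiniteField.exists_nonsquare (F := ZMod p) (by rwa [ZMod.ringChar_zmod_n])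
  have hn0 : n ≠ 0 := by
    rintro rfl
    exact hn (IsSquare.zero)
  have hXdeg : (X ^ p - X : (ZMod p)[X]).natDegree = p :=
    FiniteField.X_pow_card_sub_X_natDegree_eq (ZMod p) hp.one_lt
  have hXm : (X ^ p - X : (ZMod p)[X]).Monic :=
    monic_X_pow_sub (by rw [degree_X]; exact_mod_cast hp.one_lt)
  have hGm := hXm.mul hm
  have hGdeg : ((X ^ p - X) * h).natDegree = d := by rw [hXm.natDegree_mul hm, hXdeg, hd]
  have hdpos : 0 < d := by have := hp.pos; omega
  have hlt : (1 : (ZMod p)[X]).degree < ((X ^ p - X) * h).degree := by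
    rw [degree_one, degree_eq_natDegree hGm.ne_zero, hGdeg]
    exact_mod_cast hdpos
  have hFm : ((X ^ p - X) * h + 1).Monic := hGm.add_of_left hlt
  have hFdeg : ((X ^ p - X) * h + 1).natDegree = d := by
    rw [natDegree_add_eq_left_of_degree_lt hlt, hGdeg]
  refine ⟨C n * ((X ^ p - X) * h + 1), ?_, ?_, ?_, ?_⟩
  · have hsep : ((X ^ p - X) * h + 1).Separable := by
      refine (isCoprime_iff_aeval_ne_zero_of_isAlgClosed _ (AlgebraicClosure (ZMod p)) _ _).2
        fun x => ?_
      by_contra! hx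
      obtain ⟨h1, h2⟩ := hx
      simp only [derivative_mul, derivative_X_pow, derivative_X,
        derivative_one, CharP.cast_eq_zero, map_add, map_mul, map_sub, map_pow, aeval_X, map_one,
        map_zero, map_neg, zero_mul, zero_sub, add_zero] at h1 h2
      exact hroot x (by linear_combination h1) (by linear_combination h2)
    have hu : IsUnit (C n : (ZMod p)[X]) := isUnit_C.2 hn0.isUnit
    exact (associated_unit_mul_left _ _ hu).squarefree_iff.2 hsep.squarefree
  · rw [natDegree_C_mul hn0, hFdeg]
  · rwa [leadingCoeff_mul, leadingCoeff_C, hFm.leadingCoeff, mul_one]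
  · intro x
    simpa [ZMod.pow_card] using hn

section CommonRoots

variable {p : ℕ} [Fact p.Prime] {K : Type*} [Field K] [CharP K p]

/-- The polynomial `1 + (X ^ p - X) * X ^ a` has no repeated root unless `p ∣ 2 * a + 1`. -/
lemma two_mul_add_one_eq_zero_of_common_root {a : ℕ} (hgcd : Nat.gcd (a + 1) (p - 1) = 2)
    {x : K} (h1 : (x ^ p - x) * x ^ a = -1)
    (h2 : (x ^ p - x) * (a * x ^ (a - 1)) = x ^ a) : 2 * (a : K) + 1 = 0 := by
  have hp := Fact.out (p := p.Prime)
  have hx : x ≠ 0 := by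
    rintro rfl
    simp [hp.ne_zero] at h1
  have h3 : (x ^ p - x) * a = x := by
    rcases a with _ | a
    · simp at h2
    · rw [Nat.add_sub_cancel, pow_succ] at h2
      exact mul_left_cancel₀ (pow_ne_zero a hx) (by linear_combination h2)
  have ha : (a : K) ≠ 0 := by
    intro ha
    rw [ha, mul_zero] at h3
    exact hx h3.symm
  have hpow : x ^ p = x ^ (p - 1) * x := by
    rw [← pow_succ, Nat.sub_add_cancel hp.one_le]
  have hu : x ^ (p - 1) * a = a + 1 :=
    mul_right_cancel₀ hx (by rw [hpow] at h3; linear_combination h3)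
  have hxa : x ^ (a + 1) = -a := by
    rw [pow_succ]
    linear_combination (a : K) * h1 - x ^ a * h3
  have hfermat : ∀ k : ℕ, (k : K) ≠ 0 → (k : K) ^ (p - 1) = 1 := fun k hk =>
    mul_right_cancel₀ hk (by
      rw [← pow_succ, Nat.sub_add_cancel hp.one_le, one_mul, ← frobenius_def, map_natCast])
  have ha1 : ((a + 1 : ℕ) : K) ≠ 0 := by
    push_cast
    rw [← hu]
    exact mul_ne_zero (pow_ne_zero _ hx) ha
  have hu1 : (x ^ (p - 1)) ^ (p - 1) = 1 := by
    have := congrArg (· ^ (p - 1)) hu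
    simp only [mul_pow] at this
    rw [hfermat a ha, mul_one] at this
    rw [this]
    exact_mod_cast hfermat _ ha1
  have heven : Even (p - 1) := even_iff_two_dvd.2 (hgcd ▸ Nat.gcd_dvd_right _ _)
  have hu2 : (x ^ (p - 1)) ^ (a + 1) = 1 := by
    rw [pow_right_comm, hxa, heven.neg_pow, hfermat a ha]
  have hu3 : (x ^ (p - 1)) ^ 2 = 1 := by
    rw [← hgcd]
    exact pow_gcd_eq_one.2 ⟨hu2, hu1⟩
  linear_combination (a : K) ^ 2 * hu3 - (x ^ (p - 1) * a + a + 1) * hu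

/-- The polynomial `1 + (X ^ p - X) * X ^ a * (X ^ p - 1)` has no repeated root when
`p ∣ 2 * a + 1` and `a` is even. -/
lemma no_common_root_X_pow_mul (hp2 : p ≠ 2) {a : ℕ} (ha : Even a)
    (hap : 2 * (a : K) + 1 = 0) {x : K} (h1 : (x ^ p - x) * (x ^ a * (x ^ p - 1)) = -1) :
    (x ^ p - x) * (a * x ^ (a - 1) * (x ^ p - 1)) ≠ x ^ a * (x ^ p - 1) := by
  intro h2
  have hp := Fact.out (p := p.Prime)
  have hodd : Odd p := hp.odd_of_ne_two hp2
  have hx : x ≠ 0 := by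
    rintro rfl
    simp [hp.ne_zero] at h1
  have hx1 : x ^ p - 1 ≠ 0 := by
    intro h
    simp [h] at h1
  have h3 : (x ^ p - x) * a = x := by
    rcases a with _ | a
    · simp at hap
    · rw [Nat.add_sub_cancel, pow_succ] at h2
      exact mul_left_cancel₀ (mul_ne_zero (pow_ne_zero a hx) hx1) (by linear_combination h2)
  have h4 : x ^ p = -x := by linear_combination -2 * h3 + (x ^ p - x) * hap
  rw [h4] at h1
  have h5 := congrArg (frobenius K p) h1
  simp only [map_mul, map_sub, map_neg, map_pow, map_one, frobenius_def, h4, ha.neg_pow] at h5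
  have h6 : 2 * x * x ^ a * 2 = 0 := by linear_combination h1 - h5
  have h20 : (2 : K) ≠ 0 := by
    have : ((2 : ℕ) : K) ≠ 0 := by
      rw [Ne, CharP.cast_eq_zero_iff K p, Nat.prime_dvd_prime_iff_eq hp Nat.prime_two]
      exact hp2
    exact_mod_cast this
  simp [hx, h20] at h6

/-- The polynomial `1 + (X ^ p - X) * (X ^ m + 1)` with `p = 2 * m + 1 ≥ 5` has no repeated
root. -/
lemma no_common_root_X_pow_add_one {m : ℕ} (hp5 : 5 ≤ p) (hpm : p = 2 * m + 1) {x : K}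
    (h1 : (x ^ p - x) * (x ^ m + 1) = -1) :
    (x ^ p - x) * (m * x ^ (m - 1)) ≠ x ^ m + 1 := by
  intro h2
  have hp := Fact.out (p := p.Prime)
  have hprime : ∀ q : ℕ, q.Prime → q < 5 → (q : K) ≠ 0 := fun q hq hlt => by
    rw [Ne, CharP.cast_eq_zero_iff K p, Nat.prime_dvd_prime_iff_eq hp hq]
    omega
  have h20 : (2 : K) ≠ 0 := by exact_mod_cast hprime 2 Nat.prime_two (by norm_num)
  have h30 : (3 : K) ≠ 0 := by exact_mod_cast hprime 3 Nat.prime_three (by norm_num)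
  have h80 : (8 : K) ≠ 0 := by
    rw [show (8 : K) = 2 ^ 3 by norm_num]
    exact pow_ne_zero 3 h20
  have hm2 : 2 * (m : K) + 1 = 0 := by
    have := CharP.cast_eq_zero K p
    rw [hpm] at this
    exact_mod_cast this
  have hxm : x * x ^ (m - 1) = x ^ m := mul_pow_sub_one (by omega) x
  set z := x ^ m with hz
  have hxp : x ^ p = x * z ^ 2 := by
    rw [hpm, hz]
    ring
  rw [hxp] at h1 h2
  have hz1 : z + 1 ≠ 0 := by
    intro h
    simp [h] at h1
  have hx : x ≠ 0 := by
    intro h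
    simp [h] at h1
  have hzq : z ^ 2 - z + 2 = 0 := by
    refine (mul_eq_zero.1 (?_ : (z + 1) * (z ^ 2 - z + 2) = 0)).resolve_left hz1
    linear_combination (-2) * h2 + (z ^ 2 - 1) * z * hm2 + 2 * (z ^ 2 - 1) * m * hxm
  have hzx : (z + 5) * x = 1 := by
    linear_combination -h1 + (z + 2) * x * hzq
  have hwq := congrArg (frobenius K p) hzq
  have hwx := congrArg (frobenius K p) hzx
  simp only [map_add, map_sub, map_mul, map_pow, map_one, map_zero, map_ofNat] at hwq hwx
  rw [frobenius_def p x, hxp] at hwx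
  set w := frobenius K p z with hw
  have hwz : (w + 5) * z ^ 2 = z + 5 :=
    mul_right_cancel₀ hx (by linear_combination hwx - hzx)
  have hcases : (w - z) * (w + z - 1) = 0 := by linear_combination hwq - hzq
  rcases mul_eq_zero.1 hcases with h | h
  · have hwz' : w = z := sub_eq_zero.1 h
    rw [hwz'] at hwz
    have hz5 : z + 5 ≠ 0 := left_ne_zero_of_mul_eq_one hzx
    have hz3 : z - 3 = 0 := by
      refine (mul_eq_zero.1 (?_ : (z + 5) * (z - 3) = 0)).resolve_left hz5
      linear_combination hwz - (z + 5) * hzq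
    exact h80 (by linear_combination hzq - (z + 2) * hz3)
  · have hw1 : w = 1 - z := by linear_combination h
    rw [hw1] at hwz
    have hz5 : 2 * z = 5 := mul_left_cancel₀ h30 (by linear_combination hwz + (z - 5) * hzq)
    have hw5 := congrArg (frobenius K p) hz5
    rw [map_mul, map_ofNat, map_ofNat, ← hw, hw1] at hw5
    exact h80 (by linear_combination -hw5 - hz5)

end CommonRoots

/-- For a prime `p ≥ 5` and a positive integer `g` with
`gcd(g+1, (p-1)/2) = 1` and `g ≥ (p-1)/2`, there exists a pointless hyperelliptic
curve of genus `g` over `F_p`. -/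
theorem pointless_hyperelliptic_stmt5
    (p : ℕ) (hp : p.Prime) (hp5 : 5 ≤ p)
    (g : ℕ) (hg : 0 < g)
    (hgcd : Nat.gcd (g + 1) ((p - 1) / 2) = 1)
    (hge : (p - 1) / 2 ≤ g) :
    ∃ f : Polynomial (ZMod p), Squarefree f ∧ f.natDegree = 2 * g + 2 ∧
      ¬ IsSquare f.leadingCoeff ∧ ∀ x : ZMod p, ¬ IsSquare (f.eval x) := by
  have : Fact p.Prime := ⟨hp⟩
  have hp2 : p ≠ 2 := by omega
  have : CharP (AlgebraicClosure (ZMod p)) p := charP_of_injective_algebraMap' (ZMod p) p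
  obtain ⟨m, hm⟩ := hp.odd_of_ne_two hp2
  have hm' : (p - 1) / 2 = m := by omega
  rw [hm'] at hgcd hge
  obtain ⟨a, ha⟩ : ∃ a, p + a = 2 * g + 2 := ⟨2 * g + 2 - p, by omega⟩
  by_cases hdvd : p ∣ 2 * a + 1
  · have hzero : 2 * (a : AlgebraicClosure (ZMod p)) + 1 = 0 := by
      exact_mod_cast (CharP.cast_eq_zero_iff (AlgebraicClosure (ZMod p)) p _).2 hdvd
    by_cases hap : p ≤ a
    · obtain ⟨b, rfl⟩ := Nat.exists_eq_add_of_le' hap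
      have hXm : (X ^ p - 1 : (ZMod p)[X]).Monic := monic_X_pow_sub_C 1 hp.ne_zero
      refine exists_squarefree_nonsquare_of_monic (h := X ^ b * (X ^ p - 1)) hp2
        ((monic_X_pow b).mul hXm) ?_ fun x h1 => ?_
      · rw [(monic_X_pow b).natDegree_mul hXm, natDegree_X_pow, ← C_1, natDegree_X_pow_sub_C, ha]
      · have hb : Even b := by
          rw [Nat.even_iff]
          omega
        have := no_common_root_X_pow_mul (x := x) hp2 hb (by simpa using hzero) (by simpa using h1)
        simpa [derivative_X_pow] using this
    · have ham : a = m := by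
        obtain ⟨c, hc⟩ := hdvd
        have hc2 : c < 2 := by
          by_contra! hc2
          have := Nat.mul_le_mul_left p hc2
          omega
        interval_cases c <;> omega
      subst ham
      have ha0 : a ≠ 0 := by omega
      refine exists_squarefree_nonsquare_of_monic (h := X ^ a + 1) hp2
        (monic_X_pow_add_C 1 ha0) ?_ fun x h1 => ?_
      · rw [← C_1, natDegree_X_pow_add_C, ha]
      · have := no_common_root_X_pow_add_one (x := x) hp5 hm (by simpa using h1)
        simpa [derivative_X_pow] using this
  · refine exists_squarefree_nonsquare_of_monic (h := X ^ a) hp2 (monic_X_pow a)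
      (by rw [natDegree_X_pow, ha]) fun x h1 h2 => hdvd ?_
    have hgcd2 : Nat.gcd (a + 1) (p - 1) = 2 := by
      have hpm : p - 1 = 2 * m := by omega
      have ham : 2 * (g + 1) = (a + 1) + (p - 1) := by omega
      rw [← Nat.gcd_add_self_left, ← ham, hpm, Nat.gcd_mul_left, hgcd]
    rw [← CharP.cast_eq_zero_iff (AlgebraicClosure (ZMod p)) p]
    push_cast
    exact two_mul_add_one_eq_zero_of_common_root (x := x) hgcd2 (by simpa using h1)
      (by simpa [derivative_X_pow] using h2)
end

section
/- Let q = p^r be a power of an odd prime p and let g be a positive integer with 2g+2 ≥ q. Let j be the least nonnegative residue of 2g+2 modulo q-1, let d = gcd(j, q-1), and let k = (2g+2-j)/(q-1). If (k-j-1)^d ≢ (k-j)^d (mod p), then the polynomial f(X) = X^{2g+2} - X^{2g+2-(q-1)} + 1 in F_q[X] is squarefree of degree 2g+2 (equivalently, it has no repeated roots in an algebraic closure of F_q). -/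
open Polynomial

/-- A natural number that is nonzero in a finite field of cardinality `q` satisfies
`(m : K) ^ (q - 1) = 1` in every extension `K`. -/
theorem natCast_pow_card_sub_one_eq_one (F : Type*) {K : Type*} [Field F] [Fintype F] [Field K]
    [Algebra F K] (m : ℕ) (hm : (m : K) ≠ 0) : (m : K) ^ (Fintype.card F - 1) = 1 := by
  have hmF : (m : F) ≠ 0 := fun h => hm (by rw [← map_natCast (algebraMap F K), h, map_zero])
  rw [← map_natCast (algebraMap F K), ← map_pow, FiniteField.pow_card_sub_one_eq_one _ hmF,
    map_one]

/-- A common zero of `X ^ n - X ^ (n - (q - 1)) + 1` and its derivative in an extension of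
`𝔽_q` forces `n ^ d = (n + 1) ^ d` in that extension, where `d = gcd (n, q - 1)`. -/
theorem natCast_pow_gcd_eq_of_repeated_root (F : Type*) {K : Type*} [Field F] [Fintype F] [Field K]
    [Algebra F K] (n : ℕ) (hn : Fintype.card F ≤ n) (a : K)
    (h0 : aeval a ((X : F[X]) ^ n - X ^ (n - (Fintype.card F - 1)) + 1) = 0)
    (h1 : aeval a (derivative ((X : F[X]) ^ n - X ^ (n - (Fintype.card F - 1)) + 1)) = 0) :
    (n : K) ^ n.gcd (Fintype.card F - 1) = (n + 1 : K) ^ n.gcd (Fintype.card F - 1) := by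
  have hqK : ((Fintype.card F : ℕ) : K) = 0 := by
    rw [← map_natCast (algebraMap F K), FiniteField.cast_card_eq_zero, map_zero]
  have hunit := natCast_pow_card_sub_one_eq_one F (K := K)
  have hq1 : 1 < Fintype.card F := Fintype.one_lt_card
  generalize Fintype.card F = q at *
  obtain ⟨m, rfl⟩ := Nat.exists_eq_add_of_le hn
  obtain ⟨e, rfl⟩ := Nat.exists_eq_add_of_lt hq1
  have hsub : 1 + e + 1 + m - (1 + e + 1 - 1) = m + 1 := by omega
  have hsub' : 1 + e + 1 - 1 = e + 1 := by omega
  rw [hsub] at h0 h1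
  rw [hsub'] at hunit ⊢
  simp only [map_add, map_sub, map_pow, aeval_X, map_one, derivative_X_pow, derivative_one,
    map_mul, map_natCast, add_zero, Nat.add_sub_cancel] at h0 h1
  have hN : ((1 + e + 1 + m : ℕ) : K) = m := by
    push_cast at hqK ⊢
    linear_combination hqK
  rw [hN] at h1 ⊢
  have ha : a ≠ 0 := by
    rintro rfl
    simp at h0
  have hc : (m : K) * a ^ (e + 1) = m + 1 := by
    have h : a ^ m * ((m : K) * a ^ (e + 1) - (m + 1)) = 0 := by
      rw [show 1 + e + 1 + m - 1 = m + (e + 1) by omega, pow_add] at h1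
      push_cast at h1
      linear_combination h1
    rcases mul_eq_zero.mp h with h | h
    · exact absurd h (pow_ne_zero _ ha)
    · exact sub_eq_zero.mp h
  have hm : (m : K) ≠ 0 := by
    intro h
    simp [h] at hc
  have hm1 : (m + 1 : K) ≠ 0 := hc ▸ mul_ne_zero hm (pow_ne_zero _ ha)
  have hum := hunit m hm
  have hum1 : (m + 1 : K) ^ (e + 1) = 1 := mod_cast hunit (m + 1) (by exact_mod_cast hm1)
  have hneg : (-1 : K) ^ (e + 1) = 1 := by
    have h : ((1 + e : ℕ) : K) = -1 := by
      push_cast at hqK ⊢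
      linear_combination hqK
    rw [← h]
    exact hunit _ (by rw [h]; simp)
  have han : a ^ (1 + e + 1 + m) = -1 * (m + 1) := by
    have e1 : a ^ (1 + e + 1 + m) = a ^ (e + 1) * a ^ (m + 1) := by ring
    rw [e1] at h0 ⊢
    linear_combination ((m : K) + 1) * h0 - a ^ (m + 1) * hc
  have hcn : (a ^ (e + 1)) ^ (1 + e + 1 + m) = 1 := by
    rw [← pow_mul, mul_comm, pow_mul, han, mul_pow, hneg, hum1, one_mul]
  have hce : (a ^ (e + 1)) ^ (e + 1) = 1 := by
    rw [← hc, mul_pow, hum, one_mul] at hum1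
    exact hum1
  rw [← hc, mul_pow, pow_gcd_eq_one.mpr ⟨hcn, hce⟩, mul_one]

/-- For `q = p^r` a power of an odd prime `p` and `g` a positive integer
with `2g+2 ≥ q`, set `j = (2g+2) mod (q-1)`, `d = gcd(j, q-1)`, `k = (2g+2-j)/(q-1)`.
If `(k-j-1)^d ≢ (k-j)^d (mod p)`, then `f = X^(2g+2) - X^(2g+2-(q-1)) + 1 ∈ F_q[X]`
is squarefree of degree `2g+2`. -/
theorem pointless_hyperelliptic_stmt6
    (p r : ℕ) (hp : p.Prime) (hpodd : Odd p) (hr : 0 < r)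
    (F : Type*) [Field F] [Fintype F] (hF : Fintype.card F = p ^ r)
    (g : ℕ) (hg : 0 < g) (hq : p ^ r ≤ 2 * g + 2)
    (j d k : ℕ)
    (hj : j = (2 * g + 2) % (p ^ r - 1))
    (hd : d = Nat.gcd j (p ^ r - 1))
    (hk : k = (2 * g + 2 - j) / (p ^ r - 1))
    (hne : (((k : ℤ) - j - 1 : ℤ) : ZMod p) ^ d ≠ (((k : ℤ) - j : ℤ) : ZMod p) ^ d) :
    Squarefree ((X : F[X]) ^ (2 * g + 2) - X ^ (2 * g + 2 - (p ^ r - 1)) + 1) ∧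
    ((X : F[X]) ^ (2 * g + 2) - X ^ (2 * g + 2 - (p ^ r - 1)) + 1).natDegree
      = 2 * g + 2 := by
  have hq2 : 1 < p ^ r := Nat.one_lt_pow hr.ne' hp.one_lt
  have : Fact p.Prime := ⟨hp⟩
  have hpF : CharP F p := by
    obtain ⟨c, hc⟩ := CharP.exists F
    obtain ⟨s, hcp, hs⟩ := FiniteField.card F c
    have : p = c := by
      have hdvd : p ∣ c ^ (s : ℕ) := by rw [← hs, hF]; exact dvd_pow_self p hr.ne'
      exact (Nat.prime_dvd_prime_iff_eq hp hcp).mp (hp.dvd_of_dvd_pow hdvd)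
    exact this ▸ hc
  refine ⟨Separable.squarefree ?_, ?_⟩
  · rw [separable_def, isCoprime_iff_aeval_ne_zero_of_isAlgClosed F (AlgebraicClosure F)]
    intro a
    by_contra! h
    obtain ⟨h0, h1⟩ := h
    rw [← hF] at h0 h1
    have key := natCast_pow_gcd_eq_of_repeated_root F (2 * g + 2) (hF ▸ hq) a h0 h1
    have hgcd : (2 * g + 2).gcd (p ^ r - 1) = d := by
      rw [hd, hj, Nat.gcd_comm, Nat.gcd_rec]
    rw [hF, hgcd] at key
    have : CharP (AlgebraicClosure F) p := charP_of_injective_algebraMap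
      (algebraMap F (AlgebraicClosure F)).injective p
    have hn : 2 * g + 2 = (p ^ r - 1) * k + j := by
      rw [hk, hj, Nat.mul_div_cancel' (Nat.dvd_sub_mod _), Nat.sub_add_cancel (Nat.mod_le _ _)]
    have hpow : ((p ^ r : ℕ) : AlgebraicClosure F) = 0 := by
      rw [Nat.cast_pow, CharP.cast_eq_zero, zero_pow hr.ne']
    have hN : ((2 * g + 2 : ℕ) : AlgebraicClosure F) = -(k - j) := by
      rw [hn, Nat.cast_add, Nat.cast_mul, Nat.cast_sub hq2.le, hpow]
      push_cast
      ring
    apply hne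
    apply (ZMod.castHom (dvd_refl p) (AlgebraicClosure F)).injective
    rw [map_pow, map_pow, map_intCast, map_intCast]
    push_cast
    rw [hN, show -((k : AlgebraicClosure F) - j) + 1 = -(k - j - 1) by ring, neg_pow,
      neg_pow ((k : AlgebraicClosure F) - j - 1)] at key
    exact (mul_left_cancel₀ (pow_ne_zero _ (by simp)) key).symm
  · have hlt : 2 * g + 2 - (p ^ r - 1) < 2 * g + 2 := by omega
    generalize 2 * g + 2 - (p ^ r - 1) = m at *
    generalize 2 * g + 2 = n at *
    rw [← C_1, natDegree_add_C, natDegree_sub_eq_left_of_natDegree_lt, natDegree_X_pow]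
    simpa using hlt
end

section
/- Let q = p^r be a power of an odd prime p and let g be a positive integer with 2g+2 ≥ q. Let j be the least nonnegative residue of 2g+2 modulo q-1, let d = gcd(j, q-1), and let k = (2g+2-j)/(q-1). Suppose γ is a repeated root of f(X) = X^{2g+2} - X^{2g+2-(q-1)} + 1 in an algebraic closure of F_q. Then γ ≠ 0, p does not divide j-k, γ^{q-1} = (j-k+1)/(j-k) (where the integers j-k+1 and j-k are interpreted in F_q via the canonical ring homomorphism), and (γ^{q-1})^d = 1; consequently (k-j-1)^d ≡ (k-j)^d (mod p). -/
open Polynomial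

/-- In characteristic `p`, a nonzero integer scalar is a `(p ^ r - 1)`-th root of unity. -/
theorem intCast_pow_sub_one_eq_one {K : Type*} [Field K] {p : ℕ} [Fact p.Prime] [CharP K p]
    (r : ℕ) {n : ℤ} (hn : (n : K) ≠ 0) : (n : K) ^ (p ^ r - 1) = 1 := by
  have h : (n : K) ^ (p ^ r) = n := by
    have := congrArg (ZMod.castHom dvd_rfl K) (ZMod.pow_card_pow (n := r) (n : ZMod p))
    rwa [map_pow, map_intCast] at this
  have hpos : 0 < p ^ r := pow_pos (Fact.out (p := p.Prime)).pos r
  apply mul_right_cancel₀ hn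
  rw [← pow_succ, Nat.sub_add_cancel hpos, h, one_mul]

/-- A repeated root `γ` of `X ^ (m + Q) - X ^ m + 1` with `m > 0` satisfies
`γ ^ m * (γ ^ Q - 1) = -1` and `(m + Q) * γ ^ Q = m`. -/
theorem repeated_root_trinomial {K : Type*} [Field K] {m Q : ℕ} (hm : 0 < m) {γ : K}
    (h : (X - C γ) ^ 2 ∣ (X : K[X]) ^ (m + Q) - X ^ m + 1) :
    γ ≠ 0 ∧ γ ^ m * (γ ^ Q - 1) = -1 ∧ ((m + Q : ℕ) : K) * γ ^ Q = m := by
  obtain ⟨s, hs⟩ := h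
  have h0 : γ ^ (m + Q) - γ ^ m + 1 = 0 := by
    simpa using congrArg (eval γ) hs
  have h1 : ((m + Q : ℕ) : K) * γ ^ (m + Q - 1) - m * γ ^ (m - 1) = 0 := by
    simpa [derivative_X_pow, derivative_pow] using congrArg (fun t => eval γ (derivative t)) hs
  have hγ : γ ≠ 0 := by
    rintro rfl
    simp [hm.ne'] at h0
  refine ⟨hγ, by linear_combination h0 - pow_add γ m Q, ?_⟩
  apply mul_right_cancel₀ (pow_ne_zero (m - 1) hγ)
  rw [show m + Q - 1 = Q + (m - 1) by omega, pow_add] at h1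
  linear_combination h1

/-- For `q = p^r` a power of an odd prime `p`, `g` positive with `2g+2 ≥ q`,
`j = (2g+2) mod (q-1)`, `d = gcd(j, q-1)`, `k = (2g+2-j)/(q-1)`: if `γ` is a repeated
root of `f = X^(2g+2) - X^(2g+2-(q-1)) + 1` in an algebraic closure of `F_q`, then
`γ ≠ 0`, `p ∤ j-k`, `γ^(q-1) = (j-k+1)/(j-k)`, `(γ^(q-1))^d = 1`, and consequently
`(k-j-1)^d ≡ (k-j)^d (mod p)`. -/
theorem pointless_hyperelliptic_stmt7
    (p r : ℕ) (hp : p.Prime) (hpodd : Odd p) (hr : 0 < r)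
    (F : Type*) [Field F] [Fintype F] (hF : Fintype.card F = p ^ r)
    (g : ℕ) (hg : 0 < g) (hq : p ^ r ≤ 2 * g + 2)
    (j d k : ℕ)
    (hj : j = (2 * g + 2) % (p ^ r - 1))
    (hd : d = Nat.gcd j (p ^ r - 1))
    (hk : k = (2 * g + 2 - j) / (p ^ r - 1))
    (γ : AlgebraicClosure F)
    (hγ : (X - C γ) ^ 2 ∣
      ((X : F[X]) ^ (2 * g + 2) - X ^ (2 * g + 2 - (p ^ r - 1)) + 1).map
        (algebraMap F (AlgebraicClosure F))) :
    γ ≠ 0 ∧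
    (((j : ℤ) - k : ℤ) : ZMod p) ≠ 0 ∧
    γ ^ (p ^ r - 1) =
      (((j : ℤ) - k + 1 : ℤ) : AlgebraicClosure F) /
        (((j : ℤ) - k : ℤ) : AlgebraicClosure F) ∧
    (γ ^ (p ^ r - 1)) ^ d = 1 ∧
    (((k : ℤ) - j - 1 : ℤ) : ZMod p) ^ d = (((k : ℤ) - j : ℤ) : ZMod p) ^ d := by
  have : Fact p.Prime := ⟨hp⟩
  have : CharP F p := charP_of_card_eq_prime_pow hF
  have : CharP (AlgebraicClosure F) p :=
    charP_of_injective_algebraMap (algebraMap F (AlgebraicClosure F)).injective p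
  have hpos : 0 < p ^ r := pow_pos hp.pos r
  obtain ⟨Q, hQ⟩ : ∃ Q, p ^ r = Q + 1 := ⟨p ^ r - 1, by omega⟩
  obtain ⟨m, hm⟩ : ∃ m, 2 * g + 2 = m + Q := ⟨2 * g + 2 - Q, by omega⟩
  have hQ' : p ^ r - 1 = Q := by omega
  have hpr : ((Q : AlgebraicClosure F) + 1) = 0 := by
    have h : ((p ^ r : ℕ) : AlgebraicClosure F) = 0 := by
      rw [Nat.cast_pow, CharP.cast_eq_zero, zero_pow hr.ne']
    rw [hQ] at h
    exact_mod_cast h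
  have hroot := fun n : ℤ => intCast_pow_sub_one_eq_one (K := AlgebraicClosure F) (p := p) r (n := n)
  rw [hQ'] at hj hd hk hγ hroot ⊢
  rw [hm] at hj hk hγ
  have hQ0 : 0 < Q := by
    have := Nat.one_lt_pow hr.ne' hp.one_lt
    omega
  have hdecomp : m + Q = k * Q + j := by
    have hdiv := Nat.div_add_mod (m + Q) Q
    have hkq : k = (m + Q) / Q := by
      rw [hk, hj, show m + Q - (m + Q) % Q = Q * ((m + Q) / Q) by omega,
        Nat.mul_div_cancel_left _ hQ0]
    rw [hkq, hj, mul_comm, hdiv]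
  have hdm : d = Nat.gcd m Q := by
    rw [hd, hj, ← Nat.gcd_rec, Nat.gcd_comm, Nat.gcd_add_self_left]
  obtain ⟨hγ0, hval, hder⟩ := repeated_root_trinomial (m := m) (Q := Q) (γ := γ) (by omega)
    (by simpa using hγ)
  have hdc : (m : AlgebraicClosure F) + Q = k * Q + j := by
    have := congrArg (Nat.cast (R := AlgebraicClosure F)) hdecomp
    push_cast at this
    exact this
  have hN : ((m + Q : ℕ) : AlgebraicClosure F) = ((j - k : ℤ) : AlgebraicClosure F) := by
    push_cast
    linear_combination hdc + k * hpr
  have hM : (m : AlgebraicClosure F) = ((j - k + 1 : ℤ) : AlgebraicClosure F) := by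
    push_cast
    linear_combination hdc + (k - 1) * hpr
  rw [hN, hM] at hder
  have hN0 : ((j - k : ℤ) : AlgebraicClosure F) ≠ 0 := by
    intro h
    rw [Int.cast_add, h] at hder
    simp at hder
  have hu : γ ^ Q = ((j - k + 1 : ℤ) : AlgebraicClosure F) / ((j - k : ℤ) : AlgebraicClosure F) :=
    eq_div_of_mul_eq hN0 (by rw [mul_comm, hder])
  have hM0 : ((j - k + 1 : ℤ) : AlgebraicClosure F) ≠ 0 := by
    rw [← hder]
    exact mul_ne_zero hN0 (pow_ne_zero _ hγ0)
  have huQ : (γ ^ Q) ^ Q = 1 := by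
    rw [hu, div_pow, hroot _ hM0, hroot _ hN0, div_one]
  have hγm : γ ^ m = ((-(j - k) : ℤ) : AlgebraicClosure F) := by
    push_cast at hder ⊢
    linear_combination ((j : AlgebraicClosure F) - k) * hval - γ ^ m * hder
  have hum : (γ ^ Q) ^ m = 1 := by
    rw [← pow_mul, mul_comm, pow_mul, hγm]
    refine hroot _ ?_
    rw [← hγm]
    exact pow_ne_zero _ hγ0
  have hud : (γ ^ Q) ^ d = 1 := by
    rw [hdm]
    exact pow_gcd_eq_one.2 ⟨hum, huQ⟩
  refine ⟨hγ0, ?_, hu, hud, ?_⟩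
  · intro h
    apply hN0
    simpa only [map_intCast, map_zero] using
      congrArg (ZMod.castHom dvd_rfl (AlgebraicClosure F)) h
  · apply (ZMod.castHom dvd_rfl (AlgebraicClosure F)).injective
    rw [map_pow, map_pow, map_intCast, map_intCast,
      show (k : ℤ) - j - 1 = -(j - k + 1) by ring, show (k : ℤ) - j = -(j - k) by ring,
      Int.cast_neg, Int.cast_neg, neg_pow, neg_pow (((j - k : ℤ) : AlgebraicClosure F)),
      ← hder, mul_pow, hud, mul_one]
end

section
/- Let q = p^r be a power of an odd prime p and let g be a positive integer with 2g+2 ≥ q. Let j be the least nonnegative residue of 2g+2 modulo q-1, let d = gcd(j, q-1), and let k = (2g+2-j)/(q-1). If (k-j-1)^d ≢ (k-j)^d (mod p), then there exists a pointless hyperelliptic curve of genus g over F_q. -/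
open Polynomial

/-- A common root of `X ^ (j + (t + 1) * s) - X ^ (j + t * s) + 1` and its derivative forces
`V ^ d = U ^ d` for `d = gcd j s`, where `-U` and `-V` are the two exponents in the field. -/
lemma pow_gcd_eq_of_trinomial_common_root {K : Type*} [Field K] {α U V : K} {s j t : ℕ}
    (hα : α ≠ 0) (hU : U ^ (s + 1) = U) (hV : V ^ (s + 1) = V) (hUV : U - V = 1)
    (hroot : α ^ (j + t * s) * (α ^ s - 1) = -1) (hder : U * α ^ s = V) :
    V ^ Nat.gcd j s = U ^ Nat.gcd j s := by
  have hm : α ^ (j + t * s) = U := by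
    linear_combination (-U) * hroot + α ^ (j + t * s) * hder + α ^ (j + t * s) * (-hUV)
  have hU0 : U ≠ 0 := hm ▸ pow_ne_zero _ hα
  have hV0 : V ≠ 0 := hder ▸ mul_ne_zero hU0 (pow_ne_zero _ hα)
  have hUs : U ^ s = 1 := mul_right_cancel₀ hU0 (by rw [← pow_succ, hU, one_mul])
  have hVs : V ^ s = 1 := mul_right_cancel₀ hV0 (by rw [← pow_succ, hV, one_mul])
  have hws : (α ^ s) ^ s = 1 := by
    have h := congrArg (· ^ s) hder
    simpa only [mul_pow, hUs, hVs, one_mul] using h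
  have hwj : (α ^ s) ^ j = 1 := by
    have h := congrArg (· ^ s) hm
    have e : (α ^ (j + t * s)) ^ s = (α ^ s) ^ j * ((α ^ s) ^ s) ^ t := by
      simp only [← pow_mul, ← pow_add]
      congr 1
      ring
    simpa only [e, hws, hUs, one_pow, mul_one] using h
  have hwd : (α ^ s) ^ Nat.gcd j s = 1 := pow_gcd_eq_one.2 ⟨hwj, hws⟩
  rw [← hder, mul_pow, hwd, mul_one]

/-- For `q = p^r` a power of an odd prime `p` and `g` positive with
`2g+2 ≥ q`, with `j = (2g+2) mod (q-1)`, `d = gcd(j, q-1)`, `k = (2g+2-j)/(q-1)`: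
if `(k-j-1)^d ≢ (k-j)^d (mod p)` then there exists a pointless hyperelliptic curve
of genus `g` over `F_q`. -/
theorem pointless_hyperelliptic_stmt8
    (p r : ℕ) (hp : p.Prime) (hpodd : Odd p) (hr : 0 < r)
    (F : Type*) [Field F] [Fintype F] (hF : Fintype.card F = p ^ r)
    (g : ℕ) (hg : 0 < g) (hq : p ^ r ≤ 2 * g + 2)
    (j d k : ℕ)
    (hj : j = (2 * g + 2) % (p ^ r - 1))
    (hd : d = Nat.gcd j (p ^ r - 1))
    (hk : k = (2 * g + 2 - j) / (p ^ r - 1))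
    (hne : (((k : ℤ) - j - 1 : ℤ) : ZMod p) ^ d ≠ (((k : ℤ) - j : ℤ) : ZMod p) ^ d) :
    ∃ f : F[X], Squarefree f ∧ f.natDegree = 2 * g + 2 ∧
      ¬ IsSquare f.leadingCoeff ∧ ∀ x : F, ¬ IsSquare (f.eval x) := by
  have : Fact p.Prime := ⟨hp⟩
  have hcharF : CharP F p := charP_of_card_eq_prime_pow hF
  have hF2 : ringChar F ≠ 2 := by
    rw [ringChar.eq F p]
    rintro rfl
    exact absurd hpodd (by decide)
  obtain ⟨a, ha⟩ := FiniteField.exists_nonsquare hF2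
  have ha0 : a ≠ 0 := by
    rintro rfl
    exact ha IsSquare.zero
  obtain ⟨s, hs⟩ : ∃ s, p ^ r = s + 1 := ⟨p ^ r - 1, by have := pow_pos hp.pos r; omega⟩
  have hs0 : 0 < s := by
    have := Nat.one_lt_pow hr.ne' hp.one_lt
    omega
  rw [hs] at hj hd hk hq
  simp only [Nat.add_sub_cancel] at hj hd hk
  have hn : 2 * g + 2 = j + k * s := by
    have h := Nat.mod_add_div (2 * g + 2) s
    rw [← hj] at h
    have e : 2 * g + 2 - j = s * ((2 * g + 2) / s) := by omega
    rw [e, Nat.mul_div_cancel_left _ hs0] at hk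
    rw [hk]
    linarith [mul_comm s ((2 * g + 2) / s)]
  have hjs : j < s := hj ▸ Nat.mod_lt _ hs0
  obtain ⟨t, rfl⟩ : ∃ t, k = t + 1 := by
    rcases k with _ | t
    · omega
    · exact ⟨t, rfl⟩
  set m := j + t * s with hm
  have hnm : 2 * g + 2 = m + s := by rw [hn, hm]; ring
  have hm0 : 0 < m := by omega
  have hdeg : (X ^ (m + s) - X ^ m + 1 : F[X]).natDegree = m + s := by
    compute_degree!
    · simp [hs0.ne', hm0.ne']
  have hmonic : (X ^ (m + s) - X ^ m + 1 : F[X]).Monic := by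
    monicity
    · simp [hs0.ne', hm0.ne']
    all_goals omega
  have hsep : (X ^ (m + s) - X ^ m + 1 : F[X]).Separable := by
    rw [Polynomial.Separable,
      Polynomial.isCoprime_iff_aeval_ne_zero_of_isAlgClosed F (AlgebraicClosure F)]
    intro α
    by_contra! h
    obtain ⟨h1, h2⟩ := h
    have hcharK : CharP (AlgebraicClosure F) p := charP_of_injective_algebraMap
      (algebraMap F (AlgebraicClosure F)).injective p
    simp only [map_add, map_sub, map_pow, aeval_X, map_one, derivative_X_pow, derivative_one,
      map_mul, map_natCast, add_zero] at h1 h2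
    have hα : α ≠ 0 := by
      rintro rfl
      simp [hm0.ne'] at h1
    have hs1 : ((s : ℕ) : AlgebraicClosure F) = -1 := by
      have h : ((p ^ r : ℕ) : AlgebraicClosure F) = 0 := by
        simp [hr.ne']
      rw [hs] at h
      push_cast at h
      linear_combination h
    let φ := ZMod.castHom (dvd_refl p) (AlgebraicClosure F)
    apply hne
    apply φ.injective
    rw [map_pow, map_pow, hd]
    have hfix : ∀ x : ZMod p, φ x ^ (s + 1) = φ x := fun x => by
      rw [← hs, ← map_pow, ZMod.pow_card_pow]
    refine pow_gcd_eq_of_trinomial_common_root (t := t) hα (hfix _) (hfix _) ?_ ?_ ?_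
    · simp
    · rw [← hm]
      linear_combination h1
    · apply mul_left_cancel₀ (pow_ne_zero (m - 1) hα)
      have e : α ^ (m + s - 1) = α ^ (m - 1) * α ^ s := by
        rw [← pow_add]
        congr 1
        omega
      rw [e, hm] at h2
      push_cast at h2
      rw [← hm, hs1] at h2
      simp only [map_intCast]
      push_cast
      linear_combination -h2
  refine ⟨C a * (X ^ (m + s) - X ^ m + 1), ?_, ?_, ?_, fun x => ?_⟩
  · exact (hsep.unit_mul (isUnit_C.2 ha0.isUnit)).squarefree
  · rw [natDegree_C_mul ha0, hdeg, hnm]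
  · rwa [leadingCoeff_mul, leadingCoeff_C, hmonic.leadingCoeff, mul_one]
  · have hx : x ^ (m + s) = x ^ m := by
      obtain ⟨i, hi⟩ : ∃ i, m = i + 1 := ⟨m - 1, by omega⟩
      have h := FiniteField.pow_card x
      rw [hF, hs] at h
      rw [hi, show i + 1 + s = i + (s + 1) by ring, pow_add, h, pow_succ]
    simpa [hx] using ha
end

section
/- Let q = p^r be a power of an odd prime p with q ≥ 7, and suppose p ≠ 11 and p ≠ 61. Then there exists a pointless hyperelliptic curve of genus q-4 over F_q. -/
open Polynomial

section
variable {F : Type*} [Field F] [Fintype F] {k : ℕ}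

/-- With `q = k + 7` elements in `F`, the polynomial `X ^ (2q - 6) - X ^ (q - 5) + 1` takes the
value `1` everywhere, since it equals `X ^ (q - 6) * (X ^ q - X) + 1`. -/
theorem eval_trinomial_eq_one (hk : Fintype.card F = k + 7) (x : F) :
    (X ^ (2 * k + 8) - X ^ (k + 2) + 1 : F[X]).eval x = 1 := by
  have h := FiniteField.pow_card x
  rw [hk] at h
  simp only [eval_add, eval_sub, eval_pow, eval_X, eval_one]
  linear_combination x ^ (k + 1) * h

/-- The discriminant of `X ^ (2q - 6) - X ^ (q - 5) + 1` over a field with `q = k + 7` elements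
vanishes only if `6 ^ 4 - 5 ^ 4 = 671` does. -/
theorem separable_trinomial (hk : Fintype.card F = k + 7) (h671 : (671 : F) ≠ 0) :
    (X ^ (2 * k + 8) - X ^ (k + 2) + 1 : F[X]).Separable := by
  let K := AlgebraicClosure F
  have pow_card_natCast (n : ℕ) : (n : K) ^ (k + 7) = n := by
    have := congrArg (algebraMap F K) (FiniteField.pow_card (n : F))
    simpa [hk] using this
  have hq : (k : K) + 7 = 0 := by
    have := congrArg (algebraMap F K) (FiniteField.cast_card_eq_zero F)
    rw [hk, map_natCast, map_zero] at this
    exact_mod_cast this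
  have h671K : (671 : K) ≠ 0 := by
    have := (map_ne_zero (algebraMap F K)).2 h671
    rwa [map_ofNat] at this
  rw [Polynomial.Separable, isCoprime_iff_aeval_ne_zero_of_isAlgClosed F K]
  intro x
  by_contra! ⟨hf, hf'⟩
  simp only [map_add, map_sub, map_pow, aeval_X, map_one] at hf
  simp only [derivative_X_pow, derivative_one, map_add, map_sub,
    map_mul, map_pow, aeval_X, map_zero, map_natCast] at hf'
  push_cast at hf'
  have hx : x ≠ 0 := by
    rintro rfl
    simp at hf
  have hy : 6 * x ^ (k + 6) = 5 := by
    refine mul_left_cancel₀ (pow_ne_zero (k + 1) hx) ?_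
    rw [show 2 * k + 7 = (k + 1) + (k + 6) by omega] at hf'
    linear_combination -hf' + (2 * x ^ (k + 1 + (k + 6)) - x ^ (k + 1)) * hq
  have hx4 : 36 * x ^ 4 = 5 := by
    linear_combination 36 * x ^ 4 * hf - (6 * x ^ (k + 6) - 1) * hy
  have hy4 : 5 * (x ^ (k + 6)) ^ 4 = 5 := by
    have h36 := pow_card_natCast 36
    have h5 := pow_card_natCast 5
    push_cast at h36 h5
    have h := congrArg (· ^ (k + 7)) hx4
    simp only [mul_pow, h36, h5] at h
    linear_combination h - (x ^ (k + 6)) ^ 4 * hx4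
  have h5 : (5 : K) = 0 := by
    refine (mul_eq_zero.1 (?_ : (5 : K) * 671 = 0)).resolve_right h671K
    generalize x ^ (k + 6) = y at hy hy4
    linear_combination -1296 * hy4 + 5 * (216 * y ^ 3 + 180 * y ^ 2 + 150 * y + 125) * hy
  exact pow_ne_zero (k + 6) hx (by linear_combination hy + (1 - x ^ (k + 6)) * h5)

end

/-- For `q = p^r` a power of an odd prime `p` with `q ≥ 7`, `p ≠ 11`, and
`p ≠ 61`, there exists a pointless hyperelliptic curve of genus `q - 4` over `F_q`. -/
theorem pointless_hyperelliptic_stmt9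
    (p r : ℕ) (hp : p.Prime) (hpodd : Odd p) (hr : 0 < r)
    (F : Type*) [Field F] [Fintype F] (hF : Fintype.card F = p ^ r)
    (hq7 : 7 ≤ p ^ r) (hp11 : p ≠ 11) (hp61 : p ≠ 61) :
    ∃ f : F[X], Squarefree f ∧ f.natDegree = 2 * (p ^ r - 4) + 2 ∧
      ¬ IsSquare f.leadingCoeff ∧ ∀ x : F, ¬ IsSquare (f.eval x) := by
  have : Fact p.Prime := ⟨hp⟩
  have hchar : CharP F p := charP_of_card_eq_prime_pow hF
  have hchar2 : ringChar F ≠ 2 := by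
    rw [ringChar.eq F p]
    rintro rfl
    exact absurd hpodd (by decide)
  obtain ⟨n, hn⟩ := FiniteField.exists_nonsquare hchar2
  have hn0 : n ≠ 0 := by
    rintro rfl
    exact hn (IsSquare.zero)
  have h671 : (671 : F) ≠ 0 := fun h ↦ by
    have hdvd : p ∣ 11 * 61 := (CharP.cast_eq_zero_iff F p _).1 (by exact_mod_cast h)
    rcases hp.dvd_mul.1 hdvd with h | h
    · exact hp11 ((Nat.prime_dvd_prime_iff_eq hp (by norm_num)).1 h)
    · exact hp61 ((Nat.prime_dvd_prime_iff_eq hp (by norm_num)).1 h)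
  obtain ⟨k, hk⟩ := Nat.exists_eq_add_of_le' hq7
  have hcard := hF.trans hk
  have hdeg : (X ^ (2 * k + 8) - X ^ (k + 2) + 1 : F[X]).natDegree = 2 * k + 8 := by
    compute_degree!
    · simp [show 2 * k + 6 ≠ k by omega]
    all_goals omega
  have hmonic : (X ^ (2 * k + 8) - X ^ (k + 2) + 1 : F[X]).Monic := by
    rw [Monic, leadingCoeff, hdeg]
    simp [coeff_X_pow, coeff_one, show 2 * k + 8 ≠ k + 2 by omega]
  refine ⟨C n * (X ^ (2 * k + 8) - X ^ (k + 2) + 1), ?_, ?_, ?_, fun x ↦ ?_⟩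
  · exact ((separable_trinomial hcard h671).unit_mul (isUnit_C.2 hn0.isUnit)).squarefree
  · rw [natDegree_C_mul hn0, hdeg]
    omega
  · rwa [leadingCoeff_mul, leadingCoeff_C, hmonic.leadingCoeff, mul_one]
  · rwa [eval_mul, eval_C, eval_trinomial_eq_one hcard, mul_one]
end

section
/- Let q = p^r be a power of an odd prime p, and let a be an integer with a ≥ 3 such that q - a ≥ (q-1)/2 and p does not divide (2a-2)^{2a-4} - (2a-3)^{2a-4}. Then there exists a pointless hyperelliptic curve of genus q-a over F_q. -/
open Polynomial

/-- A common root, in an extension `K` of `F`, of `X ^ n * (X ^ q - X) + 1` and its derivative,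
where `q = n + (k + 2)`, forces `(k + 2) ^ k = (k + 1) ^ k`. -/
theorem FiniteField.pow_eq_pow_of_common_root
    {F K : Type*} [Field F] [Fintype F] [Field K] [Algebra F K] {n k : ℕ}
    (hq : Fintype.card F = n + (k + 2)) {x : K}
    (h₁ : x ^ n * (x ^ (n + (k + 2)) - x) + 1 = 0)
    (h₂ : (n : K) * x ^ (n - 1) * (x ^ (n + (k + 2)) - x) - x ^ n = 0) :
    ((k + 2 : ℕ) : F) ^ k = ((k + 1 : ℕ) : F) ^ k := by
  have hpow (j : ℕ) : ((j : K)) ^ (n + (k + 2)) = j := by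
    have := congrArg (algebraMap F K) (FiniteField.pow_card (j : F))
    simpa [hq] using this
  have hn : (n : K) = -((k + 2 : ℕ) : K) := by
    have := congrArg (algebraMap F K) (FiniteField.cast_card_eq_zero F)
    rw [hq] at this
    push_cast at this ⊢
    simp only [map_ofNat] at this
    linear_combination this
  have hx : x ≠ 0 := by
    rintro rfl
    simp at h₁
  have hnx : (n : K) * x ^ (n - 1) * x = n * x ^ n := by
    rcases n with _ | n
    · simp
    · rw [Nat.add_sub_cancel, pow_succ]
      ring
  have hroot : x ^ (n + 1) = ((k + 2 : ℕ) : K) := by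
    linear_combination (-x) * h₂ + n * h₁ + (x ^ (n + (k + 2)) - x) * hnx - hn
  have hm : ((k + 2 : ℕ) : K) ≠ 0 := hroot ▸ pow_ne_zero _ hx
  have hk : ((k + 2 : ℕ) : K) ^ 2 * x ^ k = ((k + 1 : ℕ) : K) := by
    rw [← hroot]
    have : ((k + 1 : ℕ) : K) = ((k + 2 : ℕ) : K) - 1 := by push_cast; ring
    rw [this, ← hroot]
    linear_combination h₁
  have hfrob : (x ^ k) ^ (n + (k + 2)) = x ^ k := by
    apply mul_left_cancel₀ (pow_ne_zero 2 hm)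
    have := hpow (k + 1)
    rw [← hk, mul_pow, pow_right_comm, hpow] at this
    exact this
  have hmul : ((k + 2 : ℕ) : K) * x ^ (n + k + 1) = ((k + 1 : ℕ) : K) := by
    rw [← hk, ← hroot]
    ring
  have hK : ((k + 2 : ℕ) : K) ^ k = ((k + 1 : ℕ) : K) ^ k := by
    apply mul_right_cancel₀ (pow_ne_zero k hx)
    rw [← hmul, mul_pow]
    conv_lhs => rw [← hfrob]
    ring
  apply (algebraMap F K).injective
  rw [map_pow, map_pow, map_natCast, map_natCast, hK]

/-- The polynomial `X ^ n * (X ^ q - X) + 1` over a field with `q = n + (k + 2)` elements is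
separable unless `(k + 2) ^ k = (k + 1) ^ k`. -/
theorem FiniteField.separable_X_pow_mul_add_one
    {F : Type*} [Field F] [Fintype F] {n k : ℕ} (hq : Fintype.card F = n + (k + 2))
    (h : ((k + 2 : ℕ) : F) ^ k ≠ ((k + 1 : ℕ) : F) ^ k) :
    (X ^ n * (X ^ (n + (k + 2)) - X) + 1 : F[X]).Separable := by
  rw [Polynomial.Separable,
    Polynomial.isCoprime_iff_aeval_ne_zero_of_isAlgClosed F (AlgebraicClosure F)]
  intro x
  by_contra! hx
  obtain ⟨h₁, h₂⟩ := hx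
  refine h (FiniteField.pow_eq_pow_of_common_root (K := AlgebraicClosure F) hq (x := x) ?_ ?_)
  · simpa using h₁
  · have hc : ((n + (k + 2) : ℕ) : F[X]) = 0 := by
      rw [← hq, ← map_natCast (C : F →+* F[X]), FiniteField.cast_card_eq_zero, map_zero]
    have hd : derivative (X ^ n * (X ^ (n + (k + 2)) - X) + 1 : F[X]) =
        (n : F[X]) * X ^ (n - 1) * (X ^ (n + (k + 2)) - X) - X ^ n := by
      simp only [derivative_add, derivative_mul, derivative_sub, derivative_X_pow, derivative_X,
        derivative_one, map_natCast, hc]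
      ring
    rw [hd] at h₂
    simpa using h₂

/-- For `q = p^r` a power of an odd prime `p` and an integer `a ≥ 3` with
`q - a ≥ (q-1)/2` and `p ∤ (2a-2)^(2a-4) - (2a-3)^(2a-4)`, there exists a pointless
hyperelliptic curve of genus `q - a` over `F_q`. -/
theorem pointless_hyperelliptic_stmt10
    (p r : ℕ) (hp : p.Prime) (hpodd : Odd p) (hr : 0 < r)
    (F : Type*) [Field F] [Fintype F] (hF : Fintype.card F = p ^ r)
    (a : ℕ) (ha : 3 ≤ a)
    (hga : (p ^ r - 1) / 2 ≤ p ^ r - a)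
    (hnd : ¬ ((p : ℤ) ∣ (2 * (a : ℤ) - 2) ^ (2 * a - 4) - (2 * (a : ℤ) - 3) ^ (2 * a - 4))) :
    ∃ f : F[X], Squarefree f ∧ f.natDegree = 2 * (p ^ r - a) + 2 ∧
      ¬ IsSquare f.leadingCoeff ∧ ∀ x : F, ¬ IsSquare (f.eval x) := by
  have hqodd : Odd (p ^ r) := hpodd.pow
  have hq1 : 1 < p ^ r := Nat.one_lt_pow hr.ne' hp.one_lt
  have : Fact p.Prime := ⟨hp⟩
  have : CharP F p := charP_of_card_eq_prime_pow hF
  have hchar : ringChar F ≠ 2 := by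
    rw [ringChar.eq F p]
    rintro rfl
    exact absurd hpodd (by decide)
  obtain ⟨c, hc⟩ := FiniteField.exists_nonsquare hchar
  obtain ⟨k, rfl⟩ : ∃ b, a = b + 2 := ⟨a - 2, by omega⟩
  obtain ⟨n, hn⟩ : ∃ n, p ^ r = n + (2 * k + 2) := by
    obtain ⟨s, hs⟩ := hqodd
    exact ⟨p ^ r - (2 * k + 2), by omega⟩
  rw [hn] at hF ⊢
  have hne : ((2 * k + 2 : ℕ) : F) ^ (2 * k) ≠ ((2 * k + 1 : ℕ) : F) ^ (2 * k) := by
    intro h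
    apply hnd
    rw [← CharP.intCast_eq_zero_iff F p, show 2 * (k + 2) - 4 = 2 * k by omega]
    push_cast at h ⊢
    rw [show (2 * ((k : F) + 2) - 2) = 2 * k + 2 by ring,
      show (2 * ((k : F) + 2) - 3) = 2 * k + 1 by ring, h, sub_self]
  have hc0 : c ≠ 0 := by
    rintro rfl
    exact hc (IsSquare.zero)
  have hsep := FiniteField.separable_X_pow_mul_add_one hF hne
  have hlt : (X : F[X]).degree < ((X : F[X]) ^ (n + (2 * k + 2))).degree := by
    rw [degree_X_pow, degree_X]
    exact_mod_cast (by omega : 1 < n + (2 * k + 2))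
  have hmonic' : (X ^ (n + (2 * k + 2)) - X : F[X]).Monic := (monic_X_pow _).sub_of_left hlt
  have hmonic := (monic_X_pow (R := F) n).mul hmonic'
  have hdeg : (X ^ n * (X ^ (n + (2 * k + 2)) - X) : F[X]).natDegree
      = n + (n + (2 * k + 2)) := by
    rw [(monic_X_pow n).natDegree_mul hmonic', natDegree_X_pow,
      FiniteField.X_pow_card_sub_X_natDegree_eq F (by omega)]
  have hmonic₁ : (X ^ n * (X ^ (n + (2 * k + 2)) - X) + 1 : F[X]).Monic := by
    refine hmonic.add_of_left ?_
    rw [degree_one, ← natDegree_pos_iff_degree_pos, hdeg]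
    omega
  refine ⟨C c * (X ^ n * (X ^ (n + (2 * k + 2)) - X) + 1), ?_, ?_, ?_, fun x ↦ ?_⟩
  · exact (hsep.unit_mul (isUnit_C.2 hc0.isUnit)).squarefree
  · rw [natDegree_C_mul hc0, ← C_1, natDegree_add_C, hdeg]
    omega
  · simpa [leadingCoeff_mul, hmonic₁.leadingCoeff] using hc
  · have := FiniteField.pow_card x
    rw [hF] at this
    simpa [this] using hc
end

section
/- Let p be an odd prime, set p' = (p-1)/2, and let g be a positive integer with g ≥ p' and gcd(g+1, p') = 1. Let j be the least nonnegative residue of 2g+2 modulo p-1 and let k = (2g+2-j)/(p-1). Then the polynomial f(X) = X^{2g+2} - X^{2g+3-p} + 1 in F_p[X] has a repeated root in an algebraic closure of F_p if and only if g ≡ (p²-5)/4 + jp/2 (mod p·p') and one of the following holds: (i) p ≡ 3 (mod 8) and j ≡ 2k (mod 4); (ii) p ≡ 7 (mod 8) and j ≡ 2k+2 (mod 4); (iii) p ≡ 5 (mod 8) and j ≡ 2 (mod 4). -/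
open Polynomial

/-- A repeated root is a common root of the polynomial and its derivative. -/
lemma X_sub_C_sq_dvd_iff {K : Type*} [Field K] {f : K[X]} {γ : K} :
    (X - C γ) ^ 2 ∣ f ↔ f.IsRoot γ ∧ f.derivative.IsRoot γ := by
  rcases eq_or_ne f 0 with rfl | hf
  · simp
  · rw [← le_rootMultiplicity_iff hf, Nat.succ_le_iff, one_lt_rootMultiplicity_iff_isRoot hf]

/-- The repeated roots of `X^(2s+2h) - X^(2s) + 1` in characteristic `2h+1`. -/
lemma isRoot_and_isRoot_derivative_iff {K : Type*} [Field K] {h s : ℕ} (hs : 0 < s)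
    (hp : (2 * h + 1 : K) = 0) (γ : K) :
    ((X ^ (2 * s + 2 * h) - X ^ (2 * s) + 1 : K[X]).IsRoot γ ∧
      (X ^ (2 * s + 2 * h) - X ^ (2 * s) + 1 : K[X]).derivative.IsRoot γ) ↔
    ((2 * s - 1 : K) * (γ ^ 2) ^ h = 2 * s ∧ (γ ^ 2) ^ s = 1 - 2 * s) := by
  obtain ⟨t, rfl⟩ : ∃ t, s = t + 1 := ⟨s - 1, by omega⟩
  have e1 : 2 * (t + 1) + 2 * h - 1 = 2 * t + 1 + 2 * h := by omega
  have e2 : 2 * (t + 1) - 1 = 2 * t + 1 := by omega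
  simp only [IsRoot.def, derivative_add, derivative_sub, derivative_X_pow, derivative_one,
    eval_add, eval_sub, eval_pow, eval_X, eval_one, eval_mul, eval_C, add_zero, e1, e2,
    ← pow_mul]
  push_cast
  have hh : (2 * h : K) = -1 := by linear_combination hp
  rw [hh]
  have hexp : γ ^ (2 * (t + 1)) = γ ^ (2 * t + 1) * γ := by ring
  rw [pow_add, pow_add, hexp]
  set u := γ ^ (2 * t + 1)
  set a := γ ^ (2 * h)
  constructor
  · rintro ⟨h1, h2⟩
    have hu0 : u ≠ 0 := by
      intro h0
      simp [h0] at h1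
    have ha : (2 * (t + 1) - 1 : K) * a = 2 * (t + 1) := by
      apply mul_left_cancel₀ hu0
      linear_combination h2
    refine ⟨ha, ?_⟩
    linear_combination (2 * (t + 1) - 1 : K) * h1 - u * γ * ha
  · rintro ⟨ha, hb⟩
    have hne : (2 * (t + 1) - 1 : K) ≠ 0 := by
      intro h0
      rw [h0, zero_mul] at ha
      have : (1 : K) = 0 := by linear_combination -h0 - ha
      exact one_ne_zero this
    refine ⟨?_, ?_⟩
    · apply mul_left_cancel₀ hne
      linear_combination hb + u * γ * ha
    · linear_combination u * ha

lemma two_mul_cast_add_one_eq_zero (K : Type*) [Field K] {p h : ℕ} [CharP K p]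
    (hph : p = 2 * h + 1) : (2 * h + 1 : K) = 0 := by
  have := CharP.cast_eq_zero K p
  rw [hph] at this
  exact_mod_cast this

/-- Fermat's little theorem for integers in a field of characteristic `p = 2h + 1`. -/
lemma intCast_pow_two_mul_eq_one {K : Type*} [Field K] {p h : ℕ} [Fact p.Prime] [CharP K p]
    (hph : p = 2 * h + 1) (x : ℤ) (hx : (x : K) ≠ 0) : (x : K) ^ (2 * h) = 1 := by
  have := map_intCast (frobenius K p) x
  rw [frobenius_def] at this
  apply mul_right_cancel₀ hx
  rw [← pow_succ, ← hph, this, one_mul]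

/-- Since `h` and `s` are coprime, prescribed values of `δ ^ h` and `δ ^ s` in the prime field force
`δ ^ (p - 1) = 1`, so `δ ^ h = -1`. -/
lemma exists_pow_eq_and_pow_eq_iff {K : Type*} [Field K] [IsAlgClosed K] {p h s : ℕ}
    [Fact p.Prime] [CharP K p] (hph : p = 2 * h + 1) (hs : 0 < s) (hcop : h.Coprime s) :
    (∃ γ : K, (2 * s - 1 : K) * (γ ^ 2) ^ h = 2 * s ∧ (γ ^ 2) ^ s = 1 - 2 * s) ↔
    (4 * s = (1 : K) ∧ (-1 : K) ^ s = 2 ^ h) := by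
  have hp := two_mul_cast_add_one_eq_zero K hph
  have h2 : (2 : K) ≠ 0 := by
    intro h0
    rw [h0] at hp
    simp at hp
  constructor
  · rintro ⟨γ, ha, hb⟩
    set δ := γ ^ 2
    have hn0 : (2 * s - 1 : K) ≠ 0 := by
      intro h0
      rw [h0, zero_mul] at ha
      exact one_ne_zero (by linear_combination -h0 - ha : (1 : K) = 0)
    have hδ0 : δ ≠ 0 := by
      intro h0
      rw [h0, zero_pow hs.ne'] at hb
      exact hn0 (by linear_combination hb)
    have hn1 : (2 * s : K) ≠ 0 := by
      rw [← ha]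
      exact mul_ne_zero hn0 (pow_ne_zero _ hδ0)
    have hn0' : (2 * s - 1 : K) ^ (2 * h) = 1 := by
      simpa using intCast_pow_two_mul_eq_one (K := K) hph (2 * s - 1) (by simpa using hn0)
    have hn1' : (2 * s : K) ^ (2 * h) = 1 := by
      simpa using intCast_pow_two_mul_eq_one (K := K) hph (2 * s) (by simpa using hn1)
    have hδ1 : (δ ^ (2 * h)) ^ h = 1 := by
      rw [← pow_mul, mul_comm, pow_mul]
      have := congrArg (· ^ (2 * h)) ha
      simpa only [mul_pow (2 * (s : K) - 1), hn0', hn1', one_mul] using this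
    have hδ2 : (δ ^ (2 * h)) ^ s = 1 := by
      rw [← pow_mul, mul_comm, pow_mul, hb, ← neg_sub,
        Even.neg_pow (even_two_mul h), hn0']
    have hδ3 : δ ^ (2 * h) = 1 := by
      simpa [hcop.gcd_eq_one] using pow_gcd_eq_one.2 ⟨hδ1, hδ2⟩
    have hneg : δ ^ h = -1 := by
      rw [mul_comm, pow_mul, sq, mul_self_eq_one_iff] at hδ3
      refine hδ3.resolve_left ?_
      intro h1
      rw [h1] at ha
      exact one_ne_zero (by linear_combination -ha : (1 : K) = 0)
    have h4 : 4 * s = (1 : K) := by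
      rw [hneg] at ha
      linear_combination -ha
    refine ⟨h4, ?_⟩
    have hhalf : 2 * δ ^ s = 1 := by rw [hb]; linear_combination -h4
    have := congrArg (· ^ h) hhalf
    simp only [mul_pow, one_pow] at this
    rw [← pow_mul, mul_comm s, pow_mul, hneg] at this
    have hsq : (-1 : K) ^ s * (-1) ^ s = 1 := by rw [← mul_pow]; simp
    linear_combination (-(-1 : K) ^ s) * this + 2 ^ h * hsq
  · rintro ⟨h4, hsgn⟩
    have hsgn' : (-1 : K) ^ s = (2⁻¹) ^ h := by
      rw [inv_pow, ← hsgn, ← inv_pow, inv_neg_one]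
    obtain ⟨δ, hδ1, hδ2⟩ :=
      ((Commute.all (-1 : K) 2⁻¹).pow_eq_pow_iff_of_coprime hcop.symm).1 hsgn'
    obtain ⟨γ, rfl⟩ := IsAlgClosed.exists_pow_nat_eq δ (n := 2) two_pos
    refine ⟨γ, ?_, ?_⟩
    · rw [← hδ1]
      linear_combination -h4
    · rw [← hδ2]
      field_simp
      linear_combination h4

/-- The second supplement to quadratic reciprocity, as a sign condition. -/
lemma neg_one_pow_eq_two_pow_iff {K : Type*} [Field K] {p h : ℕ} [Fact p.Prime] [CharP K p]
    (hph : p = 2 * h + 1) (s : ℕ) :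
    (-1 : K) ^ s = 2 ^ h ↔ (Even s ↔ p % 8 = 1 ∨ p % 8 = 7) := by
  have hp2 : p ≠ 2 := by omega
  have hchar : ringChar K ≠ 2 := by rwa [ringChar.eq K p]
  have hne : (-1 : K) ≠ 1 := Ring.neg_one_ne_one_of_char_ne_two hchar
  have h2 : (2 : ZMod p) ≠ 0 := Ring.two_ne_zero (by rwa [ZMod.ringChar_zmod_n])
  have hpow : (2 : K) ^ h = if p % 8 = 1 ∨ p % 8 = 7 then 1 else -1 := by
    have hd : p / 2 = h := by omega
    have key : (2 : ZMod p) ^ h = if p % 8 = 1 ∨ p % 8 = 7 then 1 else -1 := by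
      have hsq := (ZMod.euler_criterion p h2).symm.trans (ZMod.exists_sq_eq_two_iff hp2)
      rw [hd] at hsq
      split_ifs with hc
      · exact hsq.2 hc
      · exact (hd ▸ ZMod.pow_div_two_eq_neg_one_or_one p h2).resolve_left (mt hsq.1 hc)
    have := congrArg (ZMod.castHom (dvd_refl p) K) key
    rw [map_pow, map_ofNat] at this
    split_ifs at this ⊢ <;> simpa [-ZMod.castHom_apply] using this
  rw [hpow]
  rcases Nat.even_or_odd s with hs | hs
  · rw [hs.neg_one_pow]
    split_ifs with hc <;> simp [hs, hc, hne.symm]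
  · rw [hs.neg_one_pow]
    split_ifs with hc <;> simp [hs, hc, hne]

/-- The congruence holds automatically modulo `h`, and modulo `p` it says `4g + 5 ≡ 0`. -/
lemma modEq_iff_dvd {p h g i k : ℕ} (hph : p = 2 * h + 1) (hh : 0 < h)
    (hik : g + 1 = i + k * h) :
    g ≡ (p ^ 2 - 5) / 4 + 2 * i * p / 2 [MOD p * h] ↔ p ∣ 4 * g + 5 := by
  have hcop : p.Coprime h := by
    rw [hph]
    simp
  have hsq : (p ^ 2 - 5) / 4 + 1 = h ^ 2 + h := by
    have : p ^ 2 = 4 * (h ^ 2 + h) + 1 := by rw [hph]; ring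
    have : 0 < h ^ 2 := by positivity
    omega
  have hip : 2 * i * p / 2 = i * p := by
    rw [mul_assoc, Nat.mul_div_cancel_left _ two_pos]
  rw [hip, ← Nat.modEq_and_modEq_iff_modEq_mul hcop]
  set c := (p ^ 2 - 5) / 4
  zify at hsq hik hph
  have hmodh : g ≡ c + i * p [MOD h] := by
    rw [Nat.modEq_iff_dvd]
    refine ⟨h + 1 + 2 * i - k, ?_⟩
    push_cast
    linear_combination hsq - hik + i * hph
  rw [and_iff_left hmodh, Nat.modEq_iff_dvd, ← Int.natCast_dvd_natCast]
  push_cast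
  constructor
  · rintro ⟨w, hw⟩
    refine ⟨p + 4 * i - 4 * w, ?_⟩
    linear_combination -4 * hw + 4 * hsq - (p + 2 * h + 1) * hph
  · rintro ⟨w, hw⟩
    set x : ℤ := c + i * p - g with hx
    have h4 : 4 * x = p * (p + 4 * i - w) := by
      linear_combination 4 * hx - hw + 4 * hsq - (p + 2 * h + 1) * hph
    refine ⟨p * x - (h ^ 2 + h) * (p + 4 * i - w), ?_⟩
    linear_combination -(h ^ 2 + h) * h4 - x * (p + 2 * h + 1) * hph

lemma four_mul_cast_eq_one_iff (K : Type*) [Field K] {p h g s : ℕ} [CharP K p]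
    (hph : p = 2 * h + 1) (hs : g + 1 = s + h) : 4 * s = (1 : K) ↔ p ∣ 4 * g + 5 := by
  rw [← CharP.cast_eq_zero_iff K p]
  have hp := two_mul_cast_add_one_eq_zero K hph
  have hsK : (g + 1 : K) = s + h := by exact_mod_cast congrArg (Nat.cast : ℕ → K) hs
  push_cast
  constructor <;> intro H
  · linear_combination H + 4 * hsK + 2 * hp
  · linear_combination H - 4 * hsK - 2 * hp

lemma sign_condition_iff {p h g i k s : ℕ} (hph : p = 2 * h + 1) (hs : g + 1 = s + h)
    (hcop : (g + 1).Coprime h) (hik : g + 1 = i + k * h) :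
    (Even s ↔ p % 8 = 1 ∨ p % 8 = 7) ↔
      ((p % 8 = 3 ∧ 2 * i % 4 = 2 * k % 4) ∨
       (p % 8 = 7 ∧ 2 * i % 4 = (2 * k + 2) % 4) ∨
       (p % 8 = 5 ∧ 2 * i % 4 = 2)) := by
  have hpar : (g + 1) % 2 = (i + (k % 2) * (h % 2)) % 2 := by
    rw [hik]
    simp [Nat.add_mod, Nat.mul_mod]
  have hodd : h % 2 = 1 ∨ (g + 1) % 2 = 1 := by
    by_contra! hg
    have : 2 ∣ Nat.gcd (g + 1) h := Nat.dvd_gcd (by omega) (by omega)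
    rw [hcop.gcd_eq_one] at this
    omega
  rw [Nat.even_iff]
  rcases Nat.mod_two_eq_zero_or_one h with h0 | h0 <;>
    rcases Nat.mod_two_eq_zero_or_one k with k0 | k0 <;>
    norm_num [h0, k0] at hpar <;> omega

/-- For an odd prime `p`, `p' = (p-1)/2`, and a positive integer `g` with
`g ≥ p'` and `gcd(g+1, p') = 1`, with `j = (2g+2) mod (p-1)` and `k = (2g+2-j)/(p-1)`:
the polynomial `f = X^(2g+2) - X^(2g+3-p) + 1 ∈ F_p[X]` has a repeated root in an
algebraic closure of `F_p` if and only if `g ≡ (p²-5)/4 + jp/2 (mod p·p')` and one of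
(i) `p ≡ 3 (mod 8)` and `j ≡ 2k (mod 4)`; (ii) `p ≡ 7 (mod 8)` and `j ≡ 2k+2 (mod 4)`;
(iii) `p ≡ 5 (mod 8)` and `j ≡ 2 (mod 4)` holds. -/
theorem pointless_hyperelliptic_stmt11
    (p : ℕ) [hp : Fact p.Prime] (hpodd : Odd p)
    (g : ℕ) (hg : 0 < g) (hge : (p - 1) / 2 ≤ g)
    (hgcd : Nat.gcd (g + 1) ((p - 1) / 2) = 1)
    (j k : ℕ)
    (hj : j = (2 * g + 2) % (p - 1))
    (hk : k = (2 * g + 2 - j) / (p - 1)) :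
    (∃ γ : AlgebraicClosure (ZMod p),
      (X - C γ) ^ 2 ∣
        ((X : (ZMod p)[X]) ^ (2 * g + 2) - X ^ (2 * g + 3 - p) + 1).map
          (algebraMap (ZMod p) (AlgebraicClosure (ZMod p)))) ↔
    (g ≡ (p ^ 2 - 5) / 4 + j * p / 2 [MOD p * ((p - 1) / 2)] ∧
      ((p % 8 = 3 ∧ j % 4 = 2 * k % 4) ∨
       (p % 8 = 7 ∧ j % 4 = (2 * k + 2) % 4) ∨
       (p % 8 = 5 ∧ j % 4 = 2))) := by
  obtain ⟨h, hph⟩ := hpodd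
  have hp2 := hp.out.two_le
  have e1 : p - 1 = 2 * h := by omega
  have e2 : (p - 1) / 2 = h := by omega
  rw [e2] at hge hgcd ⊢
  rw [e1] at hj hk
  have hh : 0 < h := by omega
  obtain ⟨s, hs⟩ : ∃ s, g + 1 = s + h := ⟨g + 1 - h, by omega⟩
  obtain ⟨i, rfl⟩ : ∃ i, j = 2 * i := ⟨(g + 1) % h, by rw [hj, ← Nat.mul_mod_mul_left]; rfl⟩
  have hik : g + 1 = i + k * h := by
    have hq := Nat.mod_add_div (2 * g + 2) (2 * h)
    rw [← hj] at hq
    rw [hk, ← hq, Nat.add_sub_cancel_left, Nat.mul_div_cancel_left _ (by omega)]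
    linarith
  have hcop : h.Coprime s := by
    have : (s + h).Coprime h := hs ▸ hgcd
    simpa [Nat.coprime_comm] using this
  let K := AlgebraicClosure (ZMod p)
  have : CharP K p := charP_of_injective_algebraMap (algebraMap (ZMod p) K).injective p
  rw [modEq_iff_dvd hph hh hik, ← sign_condition_iff hph hs hgcd hik,
    ← neg_one_pow_eq_two_pow_iff (K := K) hph, ← four_mul_cast_eq_one_iff K hph hs,
    ← exists_pow_eq_and_pow_eq_iff hph (by omega) hcop]
  refine exists_congr fun γ => ?_
  rw [← isRoot_and_isRoot_derivative_iff (by omega) (two_mul_cast_add_one_eq_zero K hph), X_sub_C_sq_dvd_iff,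
    show 2 * g + 2 = 2 * s + 2 * h by omega, show 2 * g + 3 - p = 2 * s by omega]
  simp [K]
end

section
/- Let q be an odd prime power and let f ∈ F_q[X] be a squarefree polynomial of degree 2g+2 such that the leading coefficient of f is not a square in F_q and f(x) is not a square in F_q for every x ∈ F_q. Then the polynomial f(X²) is squarefree of degree 4g+4 = 2(2g+1)+2, its leading coefficient is not a square in F_q, and f(x²) is not a square in F_q for every x ∈ F_q; that is, f(X²) defines a pointless hyperelliptic curve of genus 2g+1 over F_q. -/
open Polynomial

/-- If `f` is separable with `f(0) ≠ 0` and `n` is invertible in the field `K`, then `f(X ^ n)`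
is separable. -/
theorem Polynomial.Separable.expand_of_eval_zero_ne_zero {K : Type*} [Field K] {f : K[X]}
    (hf : f.Separable) (h0 : f.eval 0 ≠ 0) {n : ℕ} (hn : (n : K) ≠ 0) :
    (expand K n f).Separable := by
  have hn0 : 0 < n := Nat.pos_of_ne_zero fun h => hn (by simp [h])
  have hX : IsCoprime (expand K n f) X := by
    refine ((irreducible_X.coprime_iff_not_dvd).2 ?_).symm
    rwa [X_dvd_iff, coeff_zero_eq_eval_zero, expand_eval, zero_pow hn0.ne']
  have hC : IsCoprime (expand K n f) (n : K[X]) :=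
    ((isCoprime_one_left (x := expand K n f)).symm).of_isCoprime_of_dvd_right
      (IsUnit.dvd (by simpa using isUnit_C.2 hn.isUnit))
  rw [Polynomial.Separable, derivative_expand]
  exact (IsCoprime.map hf (expand K n).toRingHom).mul_right (hC.mul_right hX.pow_right)

/-- Over a finite field `F_q` of odd order, if `f ∈ F_q[X]` is squarefree
of degree `2g+2` with non-square leading coefficient and `f(x)` a non-square for every
`x ∈ F_q`, then `f(X²)` is squarefree of degree `2(2g+1)+2`, its leading coefficient is
not a square, and `f(x²)` is a non-square for every `x ∈ F_q`; it defines a pointless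
hyperelliptic curve of genus `2g+1` over `F_q`. -/
theorem pointless_hyperelliptic_stmt13
    (F : Type*) [Field F] [Fintype F] (hodd : Odd (Fintype.card F))
    (g : ℕ) (f : F[X]) (hsf : Squarefree f) (hdeg : f.natDegree = 2 * g + 2)
    (hlc : ¬ IsSquare f.leadingCoeff) (hval : ∀ x : F, ¬ IsSquare (f.eval x)) :
    Squarefree (f.comp (X ^ 2)) ∧
    (f.comp (X ^ 2)).natDegree = 2 * (2 * g + 1) + 2 ∧
    ¬ IsSquare (f.comp (X ^ 2)).leadingCoeff ∧
    ∀ x : F, ¬ IsSquare (f.eval (x ^ 2)) := by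
  have h2 : ((2 : ℕ) : F) ≠ 0 := by
    rw [Nat.cast_ofNat]
    refine Ring.two_ne_zero fun h => ?_
    exact (Nat.not_even_iff_odd.2 hodd) (FiniteField.even_card_iff_char_two.1 h |> Nat.even_iff.2)
  have h0 : f.eval 0 ≠ 0 := fun h => hval 0 (by rw [h]; exact IsSquare.zero)
  rw [← expand_eq_comp_X_pow]
  refine ⟨?_, ?_, ?_, fun x => hval _⟩
  · exact ((PerfectField.separable_iff_squarefree.2 hsf).expand_of_eval_zero_ne_zero h0
      h2).squarefree
  · rw [natDegree_expand, hdeg]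
    ring
  · rwa [leadingCoeff_expand two_pos]
end

section
/- Let p be an odd prime, let g be a positive integer, and let f ∈ F_p[X] be a squarefree polynomial of degree 2g+2 such that the leading coefficient of f is not a square in F_p and f(x) is not a square in F_p for every x ∈ F_p. If f has a monic irreducible factor in F_p[X] of degree 2, then there exists a pointless hyperelliptic curve of genus 2g-1 over F_p. -/
open Polynomial

namespace PointlessHyperelliptic

variable {K : Type*} [Field K]

/-- The polynomial `(2X)^m * k(a + (X² + n) / (2X))`, for `k` of degree at most `m`. -/
noncomputable def pullback (a n : K) (m : ℕ) (k : K[X]) : K[X] :=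
  ∑ i ∈ Finset.range (m + 1),
    C (k.coeff i) * (X ^ 2 + C (2 * a) * X + C n) ^ i * (C 2 * X) ^ (m - i)

theorem aeval_pullback {L : Type*} [Field L] [Algebra K L] (h2 : (2 : L) ≠ 0) (a n : K) {m : ℕ}
    {k : K[X]} (hk : k.natDegree ≤ m) {x : L} (hx : x ≠ 0) :
    aeval x (pullback a n m k) =
      (2 * x) ^ m *
        aeval ((x ^ 2 + 2 * algebraMap K L a * x + algebraMap K L n) / (2 * x)) k := by
  rw [aeval_eq_sum_range' (Nat.lt_succ_of_le hk), pullback, map_sum, Finset.mul_sum]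
  refine Finset.sum_congr rfl fun i hi => ?_
  have hx2 : 2 * x ≠ 0 := mul_ne_zero h2 hx
  have him : i ≤ m := Nat.lt_succ_iff.mp (Finset.mem_range.mp hi)
  obtain ⟨j, rfl⟩ := Nat.exists_eq_add_of_le him
  simp only [map_mul, map_pow, map_add, aeval_C, aeval_X, map_ofNat, Algebra.smul_def,
    Nat.add_sub_cancel_left, div_pow, pow_add (2 * x)]
  field_simp

theorem aeval_zero_pullback {L : Type*} [Field L] [Algebra K L] (a n : K) (m : ℕ) (k : K[X]) :
    aeval (0 : L) (pullback a n m k) = algebraMap K L (k.coeff m * n ^ m) := by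
  rw [pullback, map_sum, Finset.sum_range_succ, Finset.sum_eq_zero]
  · simp
  · intro i hi
    have : m - i ≠ 0 := by have := Finset.mem_range.mp hi; omega
    simp [this]

theorem mul_derivative_pullback (a n : K) (m : ℕ) (k : K[X]) :
    C 2 * X * derivative (pullback a n (m + 1) k) =
      C 2 * (m + 1 : K[X]) * pullback a n (m + 1) k +
        C 2 * (X ^ 2 - C n) * pullback a n m (derivative k) := by
  have hsum : pullback a n m (derivative k) = ∑ i ∈ Finset.range (m + 2),
      C (k.coeff i) * (i : K[X]) * (X ^ 2 + C (2 * a) * X + C n) ^ (i - 1) *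
        (C 2 * X) ^ (m + 1 - i) := by
    rw [Finset.sum_range_succ', pullback]
    simp [coeff_derivative]
  rw [hsum, pullback, derivative_sum, Finset.mul_sum, Finset.mul_sum, Finset.mul_sum,
    ← Finset.sum_add_distrib]
  refine Finset.sum_congr rfl fun i hi => ?_
  have him : i ≤ m + 1 := Nat.lt_succ_iff.mp (Finset.mem_range.mp hi)
  obtain ⟨j, hj⟩ := Nat.exists_eq_add_of_le him
  have hjK : (m + 1 : K[X]) = i + j := by exact_mod_cast congrArg (Nat.cast (R := K[X])) hj
  rw [hj, Nat.add_sub_cancel_left, hjK]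
  simp only [derivative_mul, derivative_pow, derivative_C, derivative_X, derivative_add, map_mul,
    map_natCast, C_ofNat, derivative_ofNat]
  rcases i with _ | i <;> rcases j with _ | j <;>
    simp only [Nat.add_sub_cancel, Nat.cast_add, Nat.cast_one, Nat.cast_zero, pow_succ] <;> ring

theorem natDegree_pullback_le (a n : K) (m : ℕ) (k : K[X]) :
    (pullback a n m k).natDegree ≤ 2 * m := by
  refine natDegree_sum_le_of_forall_le _ _ fun i hi => ?_
  have him : i ≤ m := Nat.lt_succ_iff.mp (Finset.mem_range.mp hi)
  calc _ ≤ 0 + i * 2 + (m - i) * 1 := by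
        refine natDegree_mul_le_of_le (natDegree_mul_le_of_le (natDegree_C _).le
          (natDegree_pow_le_of_le _ ?_)) (natDegree_pow_le_of_le _ ?_) <;> compute_degree
    _ ≤ 2 * m := by omega

theorem coeff_pullback (a n : K) (m : ℕ) (k : K[X]) :
    (pullback a n m k).coeff (2 * m) = k.coeff m := by
  have hmonic : (X ^ 2 + C (2 * a) * X + C n : K[X]).Monic := by monicity!
  have hdeg : (X ^ 2 + C (2 * a) * X + C n : K[X]).natDegree = 2 := by compute_degree!
  rw [pullback, finsetSum_coeff, Finset.sum_range_succ, Finset.sum_eq_zero]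
  · have h := (hmonic.pow m).coeff_natDegree
    rw [hmonic.natDegree_pow, hdeg, mul_comm m 2] at h
    simp only [Nat.sub_self, pow_zero, mul_one, zero_add, coeff_C_mul, h]
  · intro i hi
    have him := Finset.mem_range.mp hi
    refine coeff_eq_zero_of_natDegree_lt ?_
    calc _ ≤ 0 + i * 2 + (m - i) * 1 := by
          refine natDegree_mul_le_of_le (natDegree_mul_le_of_le (natDegree_C _).le
            (natDegree_pow_le_of_le _ hdeg.le)) (natDegree_pow_le_of_le _ ?_)
          compute_degree
      _ < 2 * m := by omega

theorem separable_pullback (h2 : (2 : K) ≠ 0) {a n : K} (hn : n ≠ 0) {m : ℕ} {k : K[X]}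
    (hk : k.natDegree = m + 1) (hsep : k.Separable)
    (hcop : IsCoprime k ((X - C a) ^ 2 - C n)) :
    (pullback a n (m + 1) k).Separable := by
  let L := AlgebraicClosure K
  have h2L : (2 : L) ≠ 0 := by
    have h := (map_ne_zero (algebraMap K L)).mpr h2
    rwa [map_ofNat] at h
  rw [separable_def, isCoprime_iff_aeval_ne_zero_of_isAlgClosed K L] at hsep ⊢
  rw [isCoprime_iff_aeval_ne_zero_of_isAlgClosed K L] at hcop
  intro x
  by_contra! hroot
  obtain ⟨hF, hF'⟩ := hroot
  have hx : x ≠ 0 := by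
    rintro rfl
    rw [aeval_zero_pullback, map_eq_zero, ← hk, coeff_natDegree] at hF
    refine mul_ne_zero (leadingCoeff_ne_zero.mpr ?_) (pow_ne_zero _ hn) hF
    rintro rfl
    simp at hk
  have hx2 : 2 * x ≠ 0 := mul_ne_zero h2L hx
  have hder := congrArg (aeval x) (mul_derivative_pullback a n m k)
  rw [map_mul, map_add, map_mul, map_mul, hF, hF', mul_zero, mul_zero, zero_add, map_mul,
    aeval_pullback h2L a n (by have := natDegree_derivative_le k; omega) hx] at hder
  rw [aeval_pullback h2L a n hk.le hx] at hF
  have hkR := (mul_eq_zero.mp hF).resolve_left (pow_ne_zero _ hx2)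
  have hdR := (hsep _).resolve_left (not_not.mpr hkR)
  have hxn : x ^ 2 = algebraMap K L n := by
    have := (mul_eq_zero.mp hder.symm).resolve_right (mul_ne_zero (pow_ne_zero _ hx2) hdR)
    simpa [h2, sub_eq_zero] using this
  refine (hcop _).resolve_left (not_not.mpr hkR) ?_
  have hR : (x ^ 2 + 2 * algebraMap K L a * x + algebraMap K L n) / (2 * x) =
      algebraMap K L a + x := by
    rw [div_eq_iff hx2, ← hxn]
    ring
  rw [hR]
  simp only [map_sub, map_pow, aeval_X, aeval_C, ← hxn]
  ring

theorem not_isSquare_of_mul_sq_eq {a b c d : K} (ha : ¬ IsSquare a) (hc : c ≠ 0)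
    (h : a * c ^ 2 = b * d ^ 2) : ¬ IsSquare b := by
  rintro ⟨r, rfl⟩
  exact ha ⟨r * d / c, by field_simp; linear_combination h⟩

end PointlessHyperelliptic

open PointlessHyperelliptic in
/-- Let `p` be an odd prime, `g` a positive integer, and `f ∈ F_p[X]` a
squarefree polynomial of degree `2g+2` with non-square leading coefficient and `f(x)`
a non-square for every `x ∈ F_p`. If `f` has a monic irreducible factor of degree 2,
then there exists a pointless hyperelliptic curve of genus `2g-1` over `F_p`. -/
theorem pointless_hyperelliptic_stmt15
    (p : ℕ) (hp : p.Prime) (hpodd : Odd p)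
    (g : ℕ) (hg : 0 < g)
    (f : Polynomial (ZMod p)) (hsf : Squarefree f) (hdeg : f.natDegree = 2 * g + 2)
    (hlc : ¬ IsSquare f.leadingCoeff) (hval : ∀ x : ZMod p, ¬ IsSquare (f.eval x))
    (hfac : ∃ h : Polynomial (ZMod p),
      h.Monic ∧ Irreducible h ∧ h ∣ f ∧ h.natDegree = 2) :
    ∃ F : Polynomial (ZMod p), Squarefree F ∧ F.natDegree = 2 * (2 * g - 1) + 2 ∧
      ¬ IsSquare F.leadingCoeff ∧ ∀ x : ZMod p, ¬ IsSquare (F.eval x) := by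
  have := Fact.mk hp
  have h2 : (2 : ZMod p) ≠ 0 := by
    refine Ring.two_ne_zero ?_
    rw [ZMod.ringChar_zmod_n]
    rintro rfl
    exact absurd hpodd (by decide)
  obtain ⟨h, hmonic, hirr, ⟨k, rfl⟩, hh⟩ := hfac
  obtain ⟨a, n, rfl⟩ : ∃ a n : ZMod p, h = (X - C a) ^ 2 - C n := by
    refine ⟨-(h.coeff 1 / 2), (h.coeff 1 / 2) ^ 2 - h.coeff 0, ?_⟩
    have hquad := h.as_sum_range_C_mul_X_pow
    have hc2 : h.coeff 2 = 1 := by rw [← hh]; exact hmonic.coeff_natDegree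
    have hhalf : (C (h.coeff 1) : (ZMod p)[X]) = 2 * C (h.coeff 1 / 2) := by
      rw [← C_ofNat, ← C_mul, mul_div_cancel₀ _ h2]
    rw [hh, Finset.sum_range_succ, Finset.sum_range_succ, Finset.sum_range_one, hc2, hhalf] at hquad
    nth_rw 1 [hquad]
    simp only [C_neg, C_sub, C_pow, map_one]
    ring
  have hroot : ∀ r : ZMod p, r ^ 2 ≠ n := fun r hr =>
    hirr.not_isRoot_of_natDegree_ne_one (by omega) (x := a + r) (by simp [hr])
  have hn : n ≠ 0 := fun h0 => hroot 0 (by simp [h0])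
  have hk0 : k ≠ 0 := by
    rintro rfl
    simp at hdeg
  have hkdeg : k.natDegree = 2 * g := by
    rw [hmonic.natDegree_mul' hk0, hh] at hdeg
    omega
  rw [leadingCoeff_mul, hmonic.leadingCoeff, one_mul] at hlc
  have hcoeff : (pullback a n (2 * g) k).coeff (2 * (2 * g)) = k.leadingCoeff := by
    rw [coeff_pullback, ← hkdeg, coeff_natDegree]
  have hFdeg : (pullback a n (2 * g) k).natDegree = 2 * (2 * g) :=
    natDegree_eq_of_le_of_coeff_ne_zero (natDegree_pullback_le a n _ k)
      (by rwa [hcoeff, leadingCoeff_ne_zero])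
  refine ⟨pullback a n (2 * g) k, ?_, by omega, ?_, fun x => ?_⟩
  · obtain ⟨m, hm⟩ : ∃ m, 2 * g = m + 1 := ⟨2 * g - 1, by omega⟩
    rw [hm] at hkdeg ⊢
    exact (separable_pullback h2 hn hkdeg (PerfectField.separable_iff_squarefree.mpr
      (hsf.squarefree_of_dvd (dvd_mul_left _ _)))
      (isRelPrime_iff_isCoprime.mp (squarefree_mul_iff.mp hsf).1).symm).squarefree
  · rwa [leadingCoeff, hFdeg, hcoeff]
  · rw [← coe_aeval_eq_eval]
    by_cases hx : x = 0
    · subst hx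
      rw [aeval_zero_pullback, ← hkdeg, coeff_natDegree, hkdeg]
      rintro ⟨r, hr⟩
      refine hlc ⟨r / n ^ g, ?_⟩
      field_simp
      simp only [Algebra.algebraMap_self, RingHom.id_apply] at hr
      linear_combination hr
    · have hx2 : 2 * x ≠ 0 := mul_ne_zero h2 hx
      rw [aeval_pullback h2 a n hkdeg.le hx]
      refine not_isSquare_of_mul_sq_eq (c := (2 * x) ^ (g + 1)) (d := x ^ 2 - n)
        (hval ((x ^ 2 + 2 * a * x + n) / (2 * x))) (pow_ne_zero _ hx2) ?_
      have hR : ((x ^ 2 + 2 * a * x + n) / (2 * x) - a) * (2 * x) = x ^ 2 - n + 2 * n := by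
        field_simp
        ring
      simp only [eval_mul, eval_sub, eval_pow, eval_X, eval_C, Algebra.algebraMap_self,
        RingHom.id_apply, coe_aeval_eq_eval]
      generalize (x ^ 2 + 2 * a * x + n) / (2 * x) = R at hR ⊢
      have hR2 : ((R - a) ^ 2 - n) * (2 * x) ^ 2 = (x ^ 2 - n) ^ 2 := by
        linear_combination ((R - a) * (2 * x) + (x ^ 2 + n)) * hR
      linear_combination (eval R k * (2 * x) ^ (2 * g)) * hR2
end

section
/- For every integer g ≥ 2 there exists a pointless hyperelliptic curve of genus g over F_3. -/
open Polynomial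

/-- A trinomial `X ^ m - X ^ n - 1` over `F_3` is separable when exactly one of its positive
exponents is divisible by `3`. -/
theorem separable_X_pow_sub_X_pow_sub_one {m n : ℕ} (hm : 0 < m) (hn : 0 < n)
    (h : 3 ∣ m ∧ ¬ 3 ∣ n ∨ ¬ 3 ∣ m ∧ 3 ∣ n) :
    (X ^ m - X ^ n - 1 : (ZMod 3)[X]).Separable := by
  have hX : IsCoprime (X ^ m - X ^ n - 1 : (ZMod 3)[X]) X := by
    refine ⟨-1, X ^ (m - 1) - X ^ (n - 1), ?_⟩
    rw [sub_mul, pow_sub_one_mul hm.ne', pow_sub_one_mul hn.ne']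
    ring
  have hmonomial {c : ZMod 3} (hc : c ≠ 0) (k : ℕ) :
      IsCoprime (X ^ m - X ^ n - 1 : (ZMod 3)[X]) (C c * X ^ k) :=
    (isCoprime_mul_unit_left_right (isUnit_C.mpr hc.isUnit) _ _).mpr hX.pow_right
  rw [separable_def]
  rcases h with ⟨h3, h3'⟩ | ⟨h3', h3⟩
  · have hc : -(n : ZMod 3) ≠ 0 := neg_ne_zero.mpr (by rwa [Ne, ZMod.natCast_eq_zero_iff])
    have h0 : (m : ZMod 3) = 0 := (ZMod.natCast_eq_zero_iff _ _).mpr h3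
    have hd : derivative (X ^ m - X ^ n - 1 : (ZMod 3)[X]) = C (-(n : ZMod 3)) * X ^ (n - 1) := by
      simp [derivative_X_pow, h0]
    exact hd ▸ hmonomial hc _
  · have hc : (m : ZMod 3) ≠ 0 := by rwa [Ne, ZMod.natCast_eq_zero_iff]
    have h0 : (n : ZMod 3) = 0 := (ZMod.natCast_eq_zero_iff _ _).mpr h3
    have hd : derivative (X ^ m - X ^ n - 1 : (ZMod 3)[X]) = C (m : ZMod 3) * X ^ (m - 1) := by
      simp only [derivative_sub, derivative_X_pow, derivative_one, h0, map_zero, zero_mul, sub_zero]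
    exact hd ▸ hmonomial hc _

theorem ZMod.pow_eq_pow_of_even {m n : ℕ} (hm : 0 < m) (hn : 0 < n) (hm2 : Even m)
    (hn2 : Even n) (x : ZMod 3) : x ^ m = x ^ n := by
  rcases eq_or_ne x 0 with rfl | hx
  · rw [zero_pow hm.ne', zero_pow hn.ne']
  · have hsq : x ^ 2 = 1 := ZMod.pow_card_sub_one_eq_one hx
    obtain ⟨a, rfl⟩ := hm2.two_dvd
    obtain ⟨b, rfl⟩ := hn2.two_dvd
    rw [pow_mul, pow_mul, hsq, one_pow, one_pow]

/-- For every integer `g ≥ 2` there exists a pointless hyperelliptic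
curve of genus `g` over `F_3`. -/
theorem pointless_hyperelliptic_stmt16
    (g : ℕ) (hg : 2 ≤ g) :
    ∃ f : Polynomial (ZMod 3), Squarefree f ∧ f.natDegree = 2 * g + 2 ∧
      ¬ IsSquare f.leadingCoeff ∧ ∀ x : ZMod 3, ¬ IsSquare (f.eval x) := by
  have hns : ¬ IsSquare (-1 : ZMod 3) := by decide
  obtain ⟨m, hm, hmn, hm2, h3⟩ : ∃ m, 0 < m ∧ m < 2 * g + 2 ∧ Even m ∧
      (3 ∣ m ∧ ¬ 3 ∣ 2 * g + 2 ∨ ¬ 3 ∣ m ∧ 3 ∣ 2 * g + 2) := by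
    by_cases h : (2 * g + 2) % 3 = 1
    · exact ⟨2 * g - 2, by omega, by omega, by rw [Nat.even_iff]; omega, by omega⟩
    · exact ⟨2 * g, by omega, by omega, even_two_mul g, by omega⟩
  have hdeg : (X ^ m - X ^ (2 * g + 2) - 1 : (ZMod 3)[X]).natDegree = 2 * g + 2 := by
    compute_degree!
    · simp [hmn.ne']
    · omega
    · omega
  refine ⟨X ^ m - X ^ (2 * g + 2) - 1,
    (separable_X_pow_sub_X_pow_sub_one hm (by omega) h3).squarefree, hdeg, ?_, fun x => ?_⟩
  · rw [leadingCoeff, hdeg]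
    simpa [coeff_X_pow, coeff_one, hmn.ne'] using hns
  · have hpow : x ^ m = x ^ (2 * g + 2) :=
      ZMod.pow_eq_pow_of_even hm (by omega) hm2 ⟨g + 1, by ring⟩ x
    rwa [eval_sub, eval_sub, eval_pow, eval_pow, eval_X, eval_one, hpow, sub_self, zero_sub]
end

section
/- For every integer g ≥ 2 with g ≠ 3 and g ≠ 7, there exists a pointless hyperelliptic curve of genus g over F_5. -/
open Polynomial

theorem separable_X_pow_sub_X_pow_add_one_of_left {F : Type*} [Field F] {n k : ℕ}
    (hk : 0 < k) (hkn : k < n) (hn0 : (n : F) ≠ 0) (hk0 : (k : F) = 0) :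
    (X ^ n - X ^ k + 1 : F[X]).Separable := by
  have hX : IsCoprime (X ^ n - X ^ k + 1 : F[X]) X := by
    obtain ⟨a, rfl⟩ := Nat.exists_eq_add_of_lt hk
    obtain ⟨b, rfl⟩ := Nat.exists_eq_add_of_lt hkn
    exact ⟨1, X ^ (0 + a) - X ^ (0 + a + 1 + b), by ring⟩
  have hd : derivative (X ^ n - X ^ k + 1 : F[X]) = C (n : F) * X ^ (n - 1) := by
    simp [derivative_X_pow, hk0]
  rw [Separable, hd, isCoprime_mul_unit_left_right (isUnit_C.2 hn0.isUnit)]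
  exact hX.pow_right

theorem separable_X_pow_sub_X_pow_add_one_of_right {F : Type*} [Field F] {n k : ℕ}
    (hk : 0 < k) (hkn : k < n) (hn0 : (n : F) = 0) (hk0 : (k : F) ≠ 0) :
    (X ^ n - X ^ k + 1 : F[X]).Separable := by
  have hX : IsCoprime (X ^ n - X ^ k + 1 : F[X]) X := by
    obtain ⟨a, rfl⟩ := Nat.exists_eq_add_of_lt hk
    obtain ⟨b, rfl⟩ := Nat.exists_eq_add_of_lt hkn
    exact ⟨1, X ^ (0 + a) - X ^ (0 + a + 1 + b), by ring⟩
  have hd : derivative (X ^ n - X ^ k + 1 : F[X]) = C (-(k : F)) * X ^ (k - 1) := by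
    simp [derivative_X_pow, hn0]
  rw [Separable, hd, isCoprime_mul_unit_left_right (isUnit_C.2 (neg_ne_zero.2 hk0).isUnit)]
  exact hX.pow_right

theorem separable_X_pow_three_mul_sub_X_pow_add_one {F : Type*} [Field F] {k : ℕ}
    (hk : (k : F) ≠ 0) (h23 : (23 : F) ≠ 0) :
    (X ^ (3 * k) - X ^ k + 1 : F[X]).Separable := by
  obtain ⟨m, rfl⟩ : ∃ m, k = m + 1 := Nat.exists_eq_succ_of_ne_zero (by rintro rfl; simp at hk)
  have hd : derivative (X ^ (3 * (m + 1)) - X ^ (m + 1) + 1 : F[X]) =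
      C ((m + 1 : ℕ) : F) * (X ^ m * (3 * X ^ (2 * (m + 1)) - 1)) := by
    have h3 : (C 3 : F[X]) = 3 := rfl
    simp only [derivative_add, derivative_sub, derivative_X_pow, derivative_one]
    rw [show 3 * (m + 1) - 1 = m + 2 * (m + 1) by omega, Nat.add_sub_cancel]
    push_cast [map_mul, map_add, map_natCast, h3]
    simp only [map_one]
    ring
  rw [Separable, hd, isCoprime_mul_unit_left_right (isUnit_C.2 hk.isUnit)]
  refine IsCoprime.mul_right (IsCoprime.pow_right ?_) ?_
  · exact ⟨1, X ^ m - X ^ (3 * m + 2), by ring⟩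
  · have hC : (C (23 : F)⁻¹ * 23 : F[X]) = 1 := by
      rw [← C_ofNat, ← C_mul, inv_mul_cancel₀ h23, C_1]
    refine ⟨C (23 : F)⁻¹ * (18 * X ^ (m + 1) + 27),
      C (23 : F)⁻¹ * (4 - 9 * X ^ (m + 1) - 6 * X ^ (2 * (m + 1))), ?_⟩
    linear_combination hC

/-- The trinomial `2 (X ^ n - X ^ k + 1)` takes the constant value `2` on `F_5` as soon as
`n ≡ k [MOD 4]`. -/
theorem eval_two_mul_X_pow_sub_X_pow_add_one {n k : ℕ} (hk : 0 < k) (hkn : k < n)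
    (h : n % 4 = k % 4) (x : ZMod 5) :
    (C 2 * (X ^ n - X ^ k + 1) : (ZMod 5)[X]).eval x = 2 := by
  have hx : x ^ n = x ^ k := by
    obtain ⟨j, rfl⟩ : ∃ j, n = k + 4 * j := ⟨(n - k) / 4, by omega⟩
    rcases eq_or_ne x 0 with rfl | hx
    · rw [zero_pow (by omega), zero_pow hk.ne']
    · have h4 : x ^ 4 = 1 := by
        have : Fact (Nat.Prime 5) := ⟨by norm_num⟩
        exact ZMod.pow_card_sub_one_eq_one hx
      rw [pow_add, pow_mul, h4, one_pow, mul_one]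
  simp [hx]

theorem exists_separable_X_pow_sub_X_pow_add_one {n : ℕ} (hn : Even n) (h6 : 6 ≤ n)
    (h8 : n ≠ 8) (h16 : n ≠ 16) :
    ∃ k, 0 < k ∧ k < n ∧ n % 4 = k % 4 ∧ (X ^ n - X ^ k + 1 : (ZMod 5)[X]).Separable := by
  have h2 : ((2 : ℕ) : ZMod 5) ≠ 0 := by decide
  have h4 : ((4 : ℕ) : ZMod 5) ≠ 0 := by decide
  have h23 : (23 : ZMod 5) ≠ 0 := by decide
  have : Fact (Nat.Prime 5) := ⟨by norm_num⟩
  have hn2 := Nat.even_iff.1 hn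
  by_cases hn3 : n = 6 ∨ n = 12
  · rcases hn3 with rfl | rfl
    · exact ⟨2, by norm_num, by norm_num, by norm_num,
        by simpa only [Nat.reduceMul] using separable_X_pow_three_mul_sub_X_pow_add_one h2 h23⟩
    · exact ⟨4, by norm_num, by norm_num, by norm_num,
        by simpa only [Nat.reduceMul] using separable_X_pow_three_mul_sub_X_pow_add_one h4 h23⟩
  have key : ∃ k, 0 < k ∧ k < n ∧ n % 4 = k % 4 ∧ (5 ∣ n ∧ ¬ 5 ∣ k ∨ ¬ 5 ∣ n ∧ 5 ∣ k) := by
    by_cases h5 : 5 ∣ n <;> rcases (by omega : n % 4 = 0 ∨ n % 4 = 2) with hn4 | hn4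
    · exact ⟨4, by omega⟩
    · exact ⟨2, by omega⟩
    · exact ⟨20, by omega⟩
    · exact ⟨10, by omega⟩
  obtain ⟨k, hk, hkn, hmod, h⟩ := key
  simp only [← ZMod.natCast_eq_zero_iff] at h
  refine ⟨k, hk, hkn, hmod, ?_⟩
  rcases h with ⟨hn0, hk0⟩ | ⟨hn0, hk0⟩
  · exact separable_X_pow_sub_X_pow_add_one_of_right hk hkn hn0 hk0
  · exact separable_X_pow_sub_X_pow_add_one_of_left hk hkn hn0 hk0

/-- For every integer `g ≥ 2` with `g ≠ 3` and `g ≠ 7`, there exists a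
pointless hyperelliptic curve of genus `g` over `F_5`. -/
theorem pointless_hyperelliptic_stmt17
    (g : ℕ) (hg : 2 ≤ g) (hg3 : g ≠ 3) (hg7 : g ≠ 7) :
    ∃ f : Polynomial (ZMod 5), Squarefree f ∧ f.natDegree = 2 * g + 2 ∧
      ¬ IsSquare f.leadingCoeff ∧ ∀ x : ZMod 5, ¬ IsSquare (f.eval x) := by
  have h2 : (2 : ZMod 5) ≠ 0 := by decide
  have hsq : ¬ IsSquare (2 : ZMod 5) := by decide
  have : Fact (Nat.Prime 5) := ⟨by norm_num⟩
  obtain ⟨k, hk, hkn, hmod, hsep⟩ := exists_separable_X_pow_sub_X_pow_add_one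
    (n := 2 * g + 2) (by simp [parity_simps]) (by omega) (by omega) (by omega)
  have hdeg : (X ^ (2 * g + 2) - X ^ k + 1 : (ZMod 5)[X]).natDegree = 2 * g + 2 := by
    compute_degree!
    · simp [hkn.ne']
    all_goals exact hkn.le
  have hlc : (X ^ (2 * g + 2) - X ^ k + 1 : (ZMod 5)[X]).leadingCoeff = 1 := by
    rw [leadingCoeff, hdeg]
    simp [coeff_X_pow, coeff_one, hkn.ne']
  refine ⟨C 2 * (X ^ (2 * g + 2) - X ^ k + 1), ?_, ?_, ?_, fun x ↦ ?_⟩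
  · exact (hsep.unit_mul (isUnit_C.2 h2.isUnit)).squarefree
  · rw [natDegree_C_mul h2, hdeg]
  · rwa [leadingCoeff_mul, leadingCoeff_C, hlc, mul_one]
  · rwa [eval_two_mul_X_pow_sub_X_pow_add_one hk hkn hmod]
end
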